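/- arXiv:1604.06973 — 2 statements merged into one kernel-verified Lean document; each statement's English description precedes it below -/
import Mathlib

section
/- Let X be an infinite set and α an automorphism of Fact(X). Then there is an order automorphism β of the poset Eq*(X) such that: (1) for every positive integer n, θ is an n-relation if and only if β(θ) is an n-relation; and (2) for every factor pair (θ,θ') of X with θ ∈ Eq*(X), β(θ) is the first component of α(θ,θ'). -/
/-- A factor pair is a pair of equivalence relations with `θ ∩ θ' = Δ` and `θ ∘ θ' = ∇`. -/
def IsFactorPair {X : Type*} (θ θ' : Setoid X) : Prop :=
  (∀ x y : X, θ x y ∧ θ' x y ↔ x = y) ∧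
  ∀ x y : X, Relation.Comp (⇑θ) (⇑θ') x y

/-- `Fact X`, the set of factor pairs of `X`. -/
def FactPair (X : Type*) : Type _ :=
  {p : Setoid X × Setoid X // IsFactorPair p.1 p.2}

/-- The order on `Fact X`: `(θ,θ') ≤ (φ,φ')` iff `φ ⊆ θ`, `θ' ⊆ φ'` and `φ∘θ' = θ'∘φ`. -/
def FactLE {X : Type*} (p q : FactPair X) : Prop :=
  q.1.1 ≤ p.1.1 ∧ p.1.2 ≤ q.1.2 ∧
    Relation.Comp (⇑q.1.1) (⇑p.1.2) = Relation.Comp (⇑p.1.2) (⇑q.1.1)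

def FactLT {X : Type*} (p q : FactPair X) : Prop :=
  FactLE p q ∧ p ≠ q

/-- The orthocomplementation `(θ,θ')^⊥ = (θ',θ)` on `Fact X`. -/
def FactPerp {X : Type*} (p : FactPair X) : FactPair X :=
  ⟨(p.1.2, p.1.1), by
    obtain ⟨h1, h2⟩ := p.2
    refine ⟨fun x y => ⟨fun h => (h1 x y).1 ⟨h.2, h.1⟩, ?_⟩, fun x y => ?_⟩
    · rintro rfl
      exact ⟨p.1.2.refl' x, p.1.1.refl' x⟩
    · obtain ⟨z, hz1, hz2⟩ := h2 y x
      exact ⟨z, p.1.2.symm' hz2, p.1.1.symm' hz1⟩⟩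

/-- `0 = (∇,Δ)` in `Fact X`. -/
def FactZero (X : Type*) : FactPair X :=
  ⟨(⊤, ⊥), by
    refine ⟨fun x y => ⟨fun h => ?_, ?_⟩, fun x y => ⟨y, ?_, ?_⟩⟩
    · simpa [Setoid.bot_def] using h.2
    · rintro rfl
      exact ⟨(⊤ : Setoid X).refl' x, (⊥ : Setoid X).refl' x⟩
    · simp [Setoid.top_def]
    · simp [Setoid.bot_def]⟩

/-- `1 = (Δ,∇)` in `Fact X`. -/
def FactOne (X : Type*) : FactPair X :=
  ⟨(⊥, ⊤), by
    refine ⟨fun x y => ⟨fun h => ?_, ?_⟩, fun x y => ⟨x, ?_, ?_⟩⟩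
    · simpa [Setoid.bot_def] using h.1
    · rintro rfl
      exact ⟨(⊥ : Setoid X).refl' x, (⊤ : Setoid X).refl' x⟩
    · simp [Setoid.bot_def]
    · simp [Setoid.top_def]⟩

/-- An atom of `Fact X`. -/
def IsFactAtom {X : Type*} (a : FactPair X) : Prop :=
  FactLT (FactZero X) a ∧ ∀ x : FactPair X, FactLT (FactZero X) x → ¬ FactLT x a

/-- An `n`-relation: every equivalence class has exactly `n` elements. -/
def IsNRel {X : Type*} (n : ℕ) (θ : Setoid X) : Prop :=
  ∀ x : X, Nat.card {y // θ x y} = n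

/-- A `p`-atom: an atom `(φ,φ')` such that `φ'` is a `p`-relation. -/
def IsPAtom {X : Type*} (p : ℕ) (a : FactPair X) : Prop :=
  IsFactAtom a ∧ IsNRel p a.1.2

/-- The image `σ(θ) = {(σ x, σ y) : (x,y) ∈ θ}` of an equivalence relation under a
permutation. -/
def permSetoid {X : Type*} (σ : Equiv.Perm X) (θ : Setoid X) : Setoid X :=
  ⟨fun a b => θ (σ.symm a) (σ.symm b),
    ⟨fun a => θ.refl' _, fun h => θ.symm' h, fun h1 h2 => θ.trans' h1 h2⟩⟩

/-- The action `Γ(σ)(θ,θ') = (σ(θ),σ(θ'))` of a permutation on factor pairs. -/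
def permFactPair {X : Type*} (σ : Equiv.Perm X) (t : FactPair X) : FactPair X :=
  ⟨(permSetoid σ t.1.1, permSetoid σ t.1.2), by
    obtain ⟨h1, h2⟩ := t.2
    refine ⟨fun x y => ⟨fun h => ?_, ?_⟩, fun x y => ?_⟩
    · exact σ.symm.injective ((h1 (σ.symm x) (σ.symm y)).1 ⟨h.1, h.2⟩)
    · rintro rfl
      exact ⟨t.1.1.refl' _, t.1.2.refl' _⟩
    · obtain ⟨w, hw1, hw2⟩ := h2 (σ.symm x) (σ.symm y)
      refine ⟨σ w, ?_, ?_⟩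
      · show t.1.1 (σ.symm x) (σ.symm (σ w))
        simpa using hw1
      · show t.1.2 (σ.symm (σ w)) (σ.symm y)
        simpa using hw2⟩

/-- An automorphism of `Fact X`: a bijection preserving `≤` in both directions and
commuting with `⊥`. -/
def IsFactAut {X : Type*} (α : FactPair X → FactPair X) : Prop :=
  Function.Bijective α ∧
  (∀ p q : FactPair X, FactLE p q ↔ FactLE (α p) (α q)) ∧
  ∀ p : FactPair X, α (FactPerp p) = FactPerp (α p)

/-- `Eq*(X)`: the equivalence relations on `X` that are `n`-relations for some `n ≥ 1`. -/
def EqStar (X : Type*) : Type _ :=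
  {θ : Setoid X // ∃ n : ℕ, 0 < n ∧ IsNRel n θ}

/-- A regular equivalence relation: any two classes are equinumerous. -/
def IsRegularRel {X : Type*} (θ : Setoid X) : Prop :=
  ∀ x y : X, Nonempty ({z // θ x z} ≃ {z // θ y z})

/-- The action of a permutation on `Eq*(X)`. -/
def permEqStar {X : Type*} (σ : Equiv.Perm X) (θ : EqStar X) : EqStar X :=
  ⟨permSetoid σ θ.1, by
    obtain ⟨n, hn, hrel⟩ := θ.2
    refine ⟨n, hn, fun x => ?_⟩
    have e : {y // (permSetoid σ θ.1) x y} ≃ {y // θ.1 (σ.symm x) y} :=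
      σ.symm.subtypeEquiv fun y => Iff.rfl
    rw [Nat.card_congr e]
    exact hrel (σ.symm x)⟩

section Aux
universe u v

theorem FactPair.ext' {X : Type u} {p q : FactPair X} (h1 : ∀ x y, p.1.1 x y ↔ q.1.1 x y)
    (h2 : ∀ x y, p.1.2 x y ↔ q.1.2 x y) : p = q := by
  apply Subtype.ext
  exact Prod.ext (Setoid.ext h1) (Setoid.ext h2)

theorem FactLE.antisymm {X : Type u} {p q : FactPair X} (h : FactLE p q) (h' : FactLE q p) :
    p = q := by
  apply Subtype.ext
  exact Prod.ext (le_antisymm h'.1 h.1) (le_antisymm h.2.1 h'.2.1)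

/-- The coordinate bijection of a factor pair. -/
noncomputable def prodEquiv {X : Type u} {θ θ' : Setoid X} (h : IsFactorPair θ θ') :
    X ≃ Quotient θ × Quotient θ' :=
  Equiv.ofBijective (fun x => (Quotient.mk θ x, Quotient.mk θ' x)) (by
    constructor
    · intro x y hxy
      have h1 := congrArg Prod.fst hxy
      have h2 := congrArg Prod.snd hxy
      exact (h.1 x y).1 ⟨Quotient.exact h1, Quotient.exact h2⟩
    · rintro ⟨a, b⟩
      induction a using Quotient.inductionOn with | _ x => ?_
      induction b using Quotient.inductionOn with | _ y => ?_
      obtain ⟨z, hz1, hz2⟩ := h.2 x y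
      exact ⟨z, Prod.ext (Quotient.sound (θ.symm' hz1)) (Quotient.sound hz2)⟩)

theorem prodEquiv_apply {X : Type u} {θ θ' : Setoid X} (h : IsFactorPair θ θ') (x : X) :
    prodEquiv h x = (Quotient.mk θ x, Quotient.mk θ' x) := rfl

/-- The factor pair of a coordinate bijection. -/
def mkE {X : Type u} {A B : Type*} (e : X ≃ A × B) : FactPair X :=
  ⟨(Setoid.ker (fun x => (e x).1), Setoid.ker (fun x => (e x).2)), by
    refine ⟨fun x y => ⟨fun h => ?_, ?_⟩, fun x y => ⟨e.symm ((e x).1, (e y).2), ?_, ?_⟩⟩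
    · exact e.injective (Prod.ext h.1 h.2)
    · rintro rfl
      exact ⟨rfl, rfl⟩
    · simp [Setoid.ker_def]
    · simp [Setoid.ker_def]⟩

theorem mkE_fst {X : Type u} {A B : Type*} (e : X ≃ A × B) (x y : X) :
    (mkE e).1.1 x y ↔ (e x).1 = (e y).1 := Iff.rfl

theorem mkE_snd {X : Type u} {A B : Type*} (e : X ≃ A × B) (x y : X) :
    (mkE e).1.2 x y ↔ (e x).2 = (e y).2 := Iff.rfl

theorem mkE_prodEquiv {X : Type u} (t : FactPair X) {A B : Type*}
    (f : Quotient t.1.1 ≃ A) (g : Quotient t.1.2 ≃ B) :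
    mkE ((prodEquiv t.2).trans (Equiv.prodCongr f g)) = t := by
  apply FactPair.ext'
  · intro x y
    rw [mkE_fst]
    simp only [Equiv.trans_apply, prodEquiv_apply, Equiv.prodCongr_apply, Prod.map_fst,
      f.apply_eq_iff_eq]
    exact Quotient.eq
  · intro x y
    rw [mkE_snd]
    simp only [Equiv.trans_apply, prodEquiv_apply, Equiv.prodCongr_apply, Prod.map_snd,
      g.apply_eq_iff_eq]
    exact Quotient.eq

/-- Size of a factor pair: number of classes of first component (0 if infinite). -/
noncomputable def sz {X : Type u} (t : FactPair X) : ℕ := Nat.card (Quotient t.1.1)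

theorem classEquiv {X : Type u} {θ θ' : Setoid X} (h : IsFactorPair θ θ') (x : X) :
    Nat.card {y // θ' x y} = Nat.card (Quotient θ) := by
  apply Nat.card_eq_of_bijective (fun y : {y // θ' x y} => Quotient.mk θ y.1)
  constructor
  · rintro ⟨y, hy⟩ ⟨z, hz⟩ hyz
    exact Subtype.ext ((h.1 y z).1 ⟨Quotient.exact hyz, θ'.trans' (θ'.symm' hy) hz⟩)
  · intro a
    induction a using Quotient.inductionOn with | _ y => ?_
    obtain ⟨z, hz1, hz2⟩ := h.2 y x
    exact ⟨⟨z, θ'.symm' hz2⟩, Quotient.sound (θ.symm' hz1)⟩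

theorem isNRel_snd_iff {X : Type u} [Nonempty X] (t : FactPair X) (n : ℕ) :
    IsNRel n t.1.2 ↔ sz t = n := by
  constructor
  · intro h
    obtain ⟨x⟩ := ‹Nonempty X›
    rw [← h x, classEquiv t.2]; rfl
  · intro h x
    rw [classEquiv t.2]; exact h

theorem isNRel_fst_iff {X : Type u} [Nonempty X] (t : FactPair X) (n : ℕ) :
    IsNRel n t.1.1 ↔ sz (FactPerp t) = n := isNRel_snd_iff (FactPerp t) n

theorem sz_mul {X : Type u} (t : FactPair X) :
    sz t * sz (FactPerp t) = Nat.card X := by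
  rw [Nat.card_congr (prodEquiv t.2), Nat.card_prod]; rfl

theorem sz_mkE {X : Type u} {A B : Type*} [Nonempty B] (e : X ≃ A × B) :
    sz (mkE e) = Nat.card A := by
  obtain ⟨b⟩ := ‹Nonempty B›
  refine Nat.card_congr (Setoid.quotientKerEquivOfSurjective _ ?_)
  intro a
  exact ⟨e.symm (a, b), by simp⟩

/-- Lifting a factor pair of the quotient. -/
def liftF {X : Type u} (w : FactPair X) (t : FactPair (Quotient w.1.1)) : FactPair X :=
  ⟨(Setoid.comap (Quotient.mk w.1.1) t.1.1, Setoid.comap (Quotient.mk w.1.1) t.1.2 ⊓ w.1.2), by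
    refine ⟨fun x y => ⟨fun h => ?_, ?_⟩, fun x y => ?_⟩
    · have h1 := (t.2.1 _ _).1 ⟨h.1, h.2.1⟩
      exact (w.2.1 x y).1 ⟨Quotient.exact h1, h.2.2⟩
    · rintro rfl
      exact ⟨Setoid.refl' _ _, Setoid.refl' _ _⟩
    · obtain ⟨c, hc1, hc2⟩ := t.2.2 (Quotient.mk w.1.1 x) (Quotient.mk w.1.1 y)
      induction c using Quotient.inductionOn with | _ v => ?_
      obtain ⟨z, hz1, hz2⟩ := w.2.2 v y
      have : Quotient.mk w.1.1 v = Quotient.mk w.1.1 z := Quotient.sound hz1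
      rw [this] at hc1 hc2
      exact ⟨z, hc1, hc2, hz2⟩⟩

theorem liftF_fst {X : Type u} (w : FactPair X) (t : FactPair (Quotient w.1.1)) (x y : X) :
    (liftF w t).1.1 x y ↔ t.1.1 (Quotient.mk w.1.1 x) (Quotient.mk w.1.1 y) := Iff.rfl

theorem liftF_snd {X : Type u} (w : FactPair X) (t : FactPair (Quotient w.1.1)) (x y : X) :
    (liftF w t).1.2 x y ↔ t.1.2 (Quotient.mk w.1.1 x) (Quotient.mk w.1.1 y) ∧ w.1.2 x y := Iff.rfl

theorem comp_liftF {X : Type u} (w : FactPair X) (t : FactPair (Quotient w.1.1)) (x y : X) :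
    Relation.Comp w.1.1 (liftF w t).1.2 x y ↔
      t.1.2 (Quotient.mk w.1.1 x) (Quotient.mk w.1.1 y) := by
  constructor
  · rintro ⟨z, h1, h2, -⟩
    have : Quotient.mk w.1.1 x = Quotient.mk w.1.1 z := Quotient.sound h1
    rw [this]; exact h2
  · intro h
    obtain ⟨z, hz1, hz2⟩ := w.2.2 x y
    refine ⟨z, hz1, ?_, hz2⟩
    have : Quotient.mk w.1.1 x = Quotient.mk w.1.1 z := Quotient.sound hz1
    rw [this] at h; exact h

theorem comp_liftF' {X : Type u} (w : FactPair X) (t : FactPair (Quotient w.1.1)) (x y : X) :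
    Relation.Comp (liftF w t).1.2 w.1.1 x y ↔
      t.1.2 (Quotient.mk w.1.1 x) (Quotient.mk w.1.1 y) := by
  have h := comp_liftF w t y x
  constructor
  · rintro ⟨z, h1, h2⟩
    exact Setoid.symm' _ (h.1 ⟨z, Setoid.symm' _ h2, Setoid.symm' _ h1⟩)
  · intro h'
    obtain ⟨z, h1, h2⟩ := h.2 (Setoid.symm' _ h')
    exact ⟨z, Setoid.symm' _ h2, Setoid.symm' _ h1⟩

theorem liftF_le {X : Type u} (w : FactPair X) (t : FactPair (Quotient w.1.1)) :
    FactLE (liftF w t) w := by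
  refine ⟨?_, ?_, ?_⟩
  · intro x y h
    rw [liftF_fst, show Quotient.mk w.1.1 x = Quotient.mk w.1.1 y from Quotient.sound h]
  · intro x y h
    exact h.2
  · funext x y
    rw [comp_liftF, comp_liftF']

theorem liftF_injective {X : Type u} (w : FactPair X) : Function.Injective (liftF w) := by
  intro s t h
  apply FactPair.ext'
  · intro a b
    induction a using Quotient.inductionOn with | _ x => ?_
    induction b using Quotient.inductionOn with | _ y => ?_
    rw [← liftF_fst, ← liftF_fst, h]
  · intro a b
    induction a using Quotient.inductionOn with | _ x => ?_
    induction b using Quotient.inductionOn with | _ y => ?_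
    rw [← comp_liftF, ← comp_liftF, h]

theorem liftF_surj {X : Type u} {w p : FactPair X} (h : FactLE p w) : ∃ t, liftF w t = p := by
  obtain ⟨h1, h2, h3⟩ := h
  have hout : ∀ x, w.1.1 (Quotient.mk w.1.1 x).out x := fun x => Quotient.exact (Quotient.out_eq _)
  have hcomm : ∀ x y, Relation.Comp w.1.1 p.1.2 x y ↔ Relation.Comp p.1.2 w.1.1 x y := by
    intro x y; rw [h3]
  let P : Setoid (Quotient w.1.1) := Setoid.comap Quotient.out p.1.1
  let C : Setoid X := ⟨fun x y => Relation.Comp w.1.1 p.1.2 x y, by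
    refine ⟨fun x => ⟨x, Setoid.refl' _ x, Setoid.refl' _ x⟩, ?_, ?_⟩
    · rintro x y ⟨z, hz1, hz2⟩
      exact (hcomm _ _).2 ⟨z, Setoid.symm' _ hz2, Setoid.symm' _ hz1⟩
    · rintro x y z ⟨a, ha1, ha2⟩ hyz
      obtain ⟨b, hb1, hb2⟩ := hyz
      obtain ⟨c, hc1, hc2⟩ := (hcomm a b).2 ⟨y, ha2, hb1⟩
      exact ⟨c, Setoid.trans' _ ha1 hc1, Setoid.trans' _ hc2 hb2⟩⟩
  have hwC : w.1.1 ≤ C := fun {x y} hxy => ⟨y, hxy, Setoid.refl' _ y⟩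
  have hpC : p.1.2 ≤ C := fun {x y} hxy => ⟨x, Setoid.refl' _ x, hxy⟩
  have hCsub : ∀ x y, C x y → w.1.2 x y → p.1.2 x y := by
    rintro x y ⟨z, hz1, hz2⟩ hxy
    have : x = z := (w.2.1 x z).1 ⟨hz1, Setoid.trans' _ hxy (Setoid.symm' _ (h2 hz2))⟩
    rw [this]; exact hz2
  let Q : Setoid (Quotient w.1.1) := Setoid.comap Quotient.out C
  have hP : ∀ x y, P (Quotient.mk w.1.1 x) (Quotient.mk w.1.1 y) ↔ p.1.1 x y := by
    intro x y
    have hx := h1 (hout x)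
    have hy := h1 (hout y)
    constructor
    · intro h
      exact Setoid.trans' _ (Setoid.symm' _ hx) (Setoid.trans' _ h hy)
    · intro h
      exact p.1.1.trans' hx (p.1.1.trans' h (p.1.1.symm' hy))
  have hQ : ∀ x y, Q (Quotient.mk w.1.1 x) (Quotient.mk w.1.1 y) ↔ C x y := by
    intro x y
    have hx := hwC (hout x)
    have hy := hwC (hout y)
    constructor
    · intro h
      exact Setoid.trans' _ (Setoid.symm' _ hx) (Setoid.trans' _ h hy)
    · intro h
      exact C.trans' hx (C.trans' h (C.symm' hy))
  have hPQ : IsFactorPair P Q := by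
    refine ⟨fun a b => ⟨?_, ?_⟩, fun a b => ?_⟩
    · induction a using Quotient.inductionOn with | _ x => ?_
      induction b using Quotient.inductionOn with | _ y => ?_
      rw [hP, hQ]
      rintro ⟨hp, z, hz1, hz2⟩
      have : z = y := (p.2.1 z y).1 ⟨Setoid.trans' _ (Setoid.symm' _ (h1 hz1)) hp, hz2⟩
      rw [this] at hz1
      exact Quotient.sound hz1
    · rintro rfl
      exact ⟨Setoid.refl' _ _, Setoid.refl' _ _⟩
    · induction a using Quotient.inductionOn with | _ x => ?_
      induction b using Quotient.inductionOn with | _ y => ?_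
      obtain ⟨z, hz1, hz2⟩ := p.2.2 x y
      exact ⟨Quotient.mk _ z, (hP _ _).2 hz1, (hQ _ _).2 (hpC hz2)⟩
  refine ⟨⟨(P, Q), hPQ⟩, ?_⟩
  apply FactPair.ext'
  · intro x y
    exact hP x y
  · intro x y
    refine (liftF_snd w ⟨(P, Q), hPQ⟩ x y).trans ?_
    constructor
    · rintro ⟨hq, hw⟩
      exact hCsub x y ((hQ x y).1 hq) hw
    · intro h
      exact ⟨(hQ x y).2 (hpC h), h2 h⟩

theorem sz_liftF {X : Type u} (w : FactPair X) (t : FactPair (Quotient w.1.1)) :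
    sz (liftF w t) = sz t := by
  apply Nat.card_eq_of_bijective
    (Quotient.map' (s₁ := (liftF w t).1.1) (s₂ := t.1.1) (Quotient.mk w.1.1) (fun x y h => h))
  constructor
  · intro a b
    induction a using Quotient.inductionOn with | _ x => ?_
    induction b using Quotient.inductionOn with | _ y => ?_
    intro h
    apply Quotient.sound
    have h' : Quotient.mk t.1.1 (Quotient.mk w.1.1 x) = Quotient.mk t.1.1 (Quotient.mk w.1.1 y) := h
    have h2 : t.1.1 (Quotient.mk w.1.1 x) (Quotient.mk w.1.1 y) := Quotient.exact h'
    exact h2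
  · intro a
    induction a using Quotient.inductionOn with | _ c => ?_
    induction c using Quotient.inductionOn with | _ x => ?_
    exact ⟨Quotient.mk _ x, rfl⟩

/-- The interval below `w` is the set of factor pairs of the quotient. -/
noncomputable def intervalEquiv {X : Type u} (w : FactPair X) :
    FactPair (Quotient w.1.1) ≃ {p : FactPair X // FactLE p w} :=
  Equiv.ofBijective (fun t => ⟨liftF w t, liftF_le w t⟩) (by
    constructor
    · intro s t h
      exact liftF_injective w (congrArg Subtype.val h)
    · rintro ⟨p, hp⟩
      obtain ⟨t, rfl⟩ := liftF_surj hp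
      exact ⟨t, rfl⟩)

theorem sz_mul_of_le {X : Type u} {w p : FactPair X} (h : FactLE p w) :
    ∃ k, sz p * k = sz w ∧ (k = 1 → p = w) := by
  obtain ⟨t, rfl⟩ := liftF_surj h
  refine ⟨sz (FactPerp t), ?_, ?_⟩
  · rw [sz_liftF, sz_mul]; rfl
  · intro hk
    have hk' : Nat.card (Quotient t.1.2) = 1 := hk
    have := (Nat.card_eq_one_iff_unique.1 hk').1
    have hall : ∀ a b, t.1.2 a b := fun a b => Quotient.exact (Subsingleton.elim _ _)
    apply FactPair.ext'
    · intro x y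
      rw [liftF_fst]
      constructor
      · intro h
        exact Quotient.exact ((t.2.1 _ _).1 ⟨h, hall _ _⟩)
      · intro h
        rw [show Quotient.mk w.1.1 x = Quotient.mk w.1.1 y from Quotient.sound h]
    · intro x y
      rw [liftF_snd]
      exact ⟨fun h => h.2, fun h => ⟨hall _ _, h⟩⟩

theorem sz_eq_one_iff {X : Type u} [Nonempty X] (a : FactPair X) :
    sz a = 1 ↔ ∀ p, FactLE a p := by
  constructor
  · intro h
    have h' : Nat.card (Quotient a.1.1) = 1 := h
    have := (Nat.card_eq_one_iff_unique.1 h').1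
    have h1 : ∀ x y, a.1.1 x y := fun x y => Quotient.exact (Subsingleton.elim _ _)
    have h2 : ∀ x y, a.1.2 x y → x = y := fun x y h => (a.2.1 x y).1 ⟨h1 x y, h⟩
    intro p
    refine ⟨fun {x y} _ => h1 x y, ?_, ?_⟩
    · intro x y h
      rw [h2 x y h]
    · funext x y
      apply propext
      constructor
      · rintro ⟨z, h3, h4⟩
        rw [h2 _ _ h4] at h3
        exact ⟨x, Setoid.refl' _ _, h3⟩
      · rintro ⟨z, h3, h4⟩
        rw [← h2 _ _ h3] at h4
        exact ⟨y, h4, Setoid.refl' _ _⟩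
  · intro h
    have h1 := (h (FactZero X)).1
    apply Nat.card_eq_one_iff_unique.2
    refine ⟨⟨?_⟩, ?_⟩
    · intro c d
      induction c using Quotient.inductionOn with | _ x => ?_
      induction d using Quotient.inductionOn with | _ y => ?_
      exact Quotient.sound (h1 trivial)
    · exact (inferInstance : Nonempty X).map (Quotient.mk _)

theorem finite_factPair (Y : Type u) [Finite Y] : Finite (FactPair Y) := by
  have h1 : Finite (Setoid Y) := by
    refine Finite.of_injective (fun (s : Setoid Y) => (fun x y => s x y : Y → Y → Prop)) ?_
    intro s t h
    exact Setoid.ext fun x y => by rw [show s x y = t x y from congrFun (congrFun h x) y]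
  unfold FactPair
  infer_instance

/-- Fibres of `mkE`. -/
theorem card_fiber {Y : Type u} {a b : ℕ} (t : FactPair Y)
    (ha : Nat.card (Quotient t.1.1) = a) (hb : Nat.card (Quotient t.1.2) = b)
    (ha0 : 0 < a) (hb0 : 0 < b) :
    Nat.card {e : Y ≃ Fin a × Fin b // mkE e = t} = a.factorial * b.factorial := by
  have : Finite (Quotient t.1.1) := Nat.finite_of_card_ne_zero (by omega)
  have : Finite (Quotient t.1.2) := Nat.finite_of_card_ne_zero (by omega)
  have fa : Quotient t.1.1 ≃ Fin a := Finite.equivFinOfCardEq ha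
  have fb : Quotient t.1.2 ≃ Fin b := Finite.equivFinOfCardEq hb
  have key : Nat.card ((Quotient t.1.1 ≃ Fin a) × (Quotient t.1.2 ≃ Fin b)) =
      Nat.card {e : Y ≃ Fin a × Fin b // mkE e = t} := by
    apply Nat.card_eq_of_bijective (fun fg => ⟨(prodEquiv t.2).trans (Equiv.prodCongr fg.1 fg.2),
      mkE_prodEquiv t fg.1 fg.2⟩)
    constructor
    · rintro ⟨f, g⟩ ⟨f', g'⟩ h
      have h' : ∀ y, ((f (Quotient.mk _ y), g (Quotient.mk _ y)) : Fin a × Fin b) =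
          (f' (Quotient.mk _ y), g' (Quotient.mk _ y)) := by
        intro y
        exact congrArg (fun e : {e : Y ≃ Fin a × Fin b // mkE e = t} => e.1 y) h
      apply Prod.ext
      · ext c
        induction c using Quotient.inductionOn with | _ y => ?_
        exact congrArg Fin.val (congrArg Prod.fst (h' y))
      · ext c
        induction c using Quotient.inductionOn with | _ y => ?_
        exact congrArg Fin.val (congrArg Prod.snd (h' y))
    · rintro ⟨e, rfl⟩
      have hsa : Function.Surjective (fun x => (e x).1) :=
        fun i => ⟨e.symm (i, ⟨0, hb0⟩), by simp⟩
      have hsb : Function.Surjective (fun x => (e x).2) :=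
        fun i => ⟨e.symm (⟨0, ha0⟩, i), by simp⟩
      refine ⟨(Setoid.quotientKerEquivOfSurjective _ hsa,
        Setoid.quotientKerEquivOfSurjective _ hsb), ?_⟩
      apply Subtype.ext
      apply Equiv.ext
      intro y
      rfl
  rw [← key, Nat.card_prod, Nat.card_congr (Equiv.equivCongr fa (Equiv.refl _)),
    Nat.card_congr (Equiv.equivCongr fb (Equiv.refl _))]
  simp [Nat.card_eq_fintype_card, Fintype.card_perm]

theorem card_type {Y : Type u} {a b : ℕ} (hY : Nat.card Y = a * b)
    (ha0 : 0 < a) (hb0 : 0 < b) :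
    Nat.card {t : FactPair Y // sz t = a} * (a.factorial * b.factorial) = (a * b).factorial := by
  have hpos : 0 < a * b := Nat.mul_pos ha0 hb0
  have : Finite Y := Nat.finite_of_card_ne_zero (by omega)
  have := finite_factPair Y
  have : Nonempty (Fin b) := ⟨⟨0, hb0⟩⟩
  have eY : Y ≃ Fin (a * b) := Finite.equivFinOfCardEq hY
  have h1 : Nat.card (Y ≃ Fin a × Fin b) = (a * b).factorial := by
    rw [Nat.card_congr (Equiv.equivCongr eY finProdFinEquiv)]
    simp [Nat.card_eq_fintype_card, Fintype.card_perm]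
  let F : (Y ≃ Fin a × Fin b) → {t : FactPair Y // sz t = a} :=
    fun e => ⟨mkE e, by rw [sz_mkE]; simp⟩
  have := Fintype.ofFinite {t : FactPair Y // sz t = a}
  rw [← h1, Nat.card_congr (Equiv.sigmaFiberEquiv F).symm, Nat.card_sigma]
  rw [Finset.sum_congr rfl (g := fun _ => a.factorial * b.factorial)]
  · simp
  · rintro ⟨t, ht⟩ -
    rw [← card_fiber t ht _ ha0 hb0]
    · apply Nat.card_congr
      apply Equiv.subtypeEquivRight
      intro e
      exact Subtype.ext_iff
    · have := sz_mul t
      rw [ht, hY] at this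
      exact Nat.eq_of_mul_eq_mul_left ha0 this

theorem card_four {Y : Type u} (hY : Nat.card Y = 4) :
    0 < Nat.card (FactPair Y) ∧ Nat.card (FactPair Y) ≤ 8 := by
  have : Finite Y := Nat.finite_of_card_ne_zero (by omega)
  have := finite_factPair Y
  have : Nonempty (FactPair Y) := ⟨FactZero Y⟩
  refine ⟨Nat.card_pos, ?_⟩
  have h1 := card_type (Y := Y) (a := 1) (b := 4) hY (by norm_num) (by norm_num)
  have h2 := card_type (Y := Y) (a := 2) (b := 2) hY (by norm_num) (by norm_num)
  have h4 := card_type (Y := Y) (a := 4) (b := 1) hY (by norm_num) (by norm_num)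
  simp [Nat.factorial] at h1 h2 h4
  have hu : (Set.univ : Set (FactPair Y)) ⊆
      ({t | sz t = 1} ∪ {t | sz t = 2}) ∪ {t | sz t = 4} := by
    intro t _
    have h := sz_mul t
    rw [hY] at h
    have hd : sz t ∣ 4 := ⟨_, h.symm⟩
    have hle : sz t ≤ 4 := Nat.le_of_dvd (by norm_num) hd
    show (sz t = 1 ∨ sz t = 2) ∨ sz t = 4
    interval_cases hs : sz t <;> omega
  have hc := Set.ncard_le_ncard hu (Set.toFinite _)
  have hc1 := Set.ncard_union_le ({t : FactPair Y | sz t = 1} ∪ {t | sz t = 2}) {t | sz t = 4}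
  have hc2 := Set.ncard_union_le {t : FactPair Y | sz t = 1} {t | sz t = 2}
  rw [Set.ncard_univ] at hc
  have e1 : Set.ncard {t : FactPair Y | sz t = 1} = Nat.card {t : FactPair Y // sz t = 1} := rfl
  have e2 : Set.ncard {t : FactPair Y | sz t = 2} = Nat.card {t : FactPair Y // sz t = 2} := rfl
  have e4 : Set.ncard {t : FactPair Y | sz t = 4} = Nat.card {t : FactPair Y // sz t = 4} := rfl
  omega

theorem factorial_bound (n k : ℕ) (hn : 3 ≤ n) (hk : 2 ≤ k) :
    8 * (n.factorial * k.factorial) < (n * k).factorial := by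
  obtain ⟨j, rfl⟩ : ∃ j, k = j + 1 := ⟨k - 1, by omega⟩
  have h1 : n + j + 2 ≤ n * (j + 1) := by nlinarith
  have h2 := Nat.factorial_le h1
  have h3 : n.factorial * j.factorial ≤ (n + j).factorial :=
    Nat.le_of_dvd (Nat.factorial_pos _) (Nat.factorial_mul_factorial_dvd_factorial_add n j)
  have h4 : (n + j + 2).factorial = (n + j + 2) * ((n + j + 1) * (n + j).factorial) := by
    rw [Nat.factorial_succ, Nat.factorial_succ]
  have h5 : (j + 1).factorial = (j + 1) * j.factorial := Nat.factorial_succ j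
  have h6 : 8 * (j + 1) < (n + j + 2) * (n + j + 1) := by nlinarith
  have h7 : 0 < n.factorial * j.factorial := Nat.mul_pos (Nat.factorial_pos _) (Nat.factorial_pos _)
  calc 8 * (n.factorial * (j + 1).factorial) = 8 * (j + 1) * (n.factorial * j.factorial) := by
        rw [h5]; ring
    _ < (n + j + 2) * (n + j + 1) * (n.factorial * j.factorial) :=
        Nat.mul_lt_mul_of_pos_right h6 h7
    _ ≤ (n + j + 2) * (n + j + 1) * (n + j).factorial := Nat.mul_le_mul_left _ h3
    _ = (n + j + 2).factorial := by rw [h4]; ring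
    _ ≤ _ := h2

theorem infinite_two {Y : Type u} [Infinite Y] : Infinite {t : FactPair Y // sz t = 2} := by
  classical
  have hc : Nonempty (Y ≃ Bool × Y) := by
    apply Cardinal.eq.1
    simp only [Cardinal.mk_prod, Cardinal.lift_id, Cardinal.lift_uzero]
    exact (Cardinal.mul_eq_right (Cardinal.aleph0_le_mk Y)
      ((Cardinal.lt_aleph0_of_finite _).le.trans (Cardinal.aleph0_le_mk Y)) (by simp)).symm
  obtain ⟨e⟩ := hc
  obtain ⟨y0, y1, hne⟩ := exists_pair_ne Y
  let x0 : Y := e.symm (false, y0)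
  let x1 : Y := e.symm (false, y1)
  have hx01 : x1 ≠ x0 := by
    intro h
    have := congrArg Prod.snd (e.symm.injective h)
    exact hne this.symm
  let E : Y → (Y ≃ Bool × Y) := fun y => (Equiv.swap x0 (e.symm (true, y))).trans e
  refine Infinite.of_injective (fun y : Y => (⟨mkE (E y), by
    rw [sz_mkE]; simp⟩ : {t : FactPair Y // sz t = 2})) ?_
  intro y y' h
  have h' : mkE (E y) = mkE (E y') := congrArg Subtype.val h
  have h1 : ∀ y, E y x1 = (false, y1) := by
    intro y
    have : x1 ≠ e.symm (true, y) := by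
      intro h
      have := congrArg Prod.fst (e.symm.injective h)
      simp at this
    simp [E, Equiv.swap_apply_of_ne_of_ne hx01 this, x1]
  have h2 : (mkE (E y)).1.1 x1 (e.symm (true, y)) := by
    rw [mkE_fst, h1]
    simp [E, x0]
  rw [h', mkE_fst, h1] at h2
  by_contra hyy
  have h3 : e.symm (true, y) ≠ x0 := by
    intro h
    have := congrArg Prod.fst (e.symm.injective h)
    simp at this
  have h4 : e.symm (true, y) ≠ e.symm (true, y') := by
    intro h
    have := congrArg Prod.snd (e.symm.injective h)
    exact hyy this
  simp [E, Equiv.swap_apply_of_ne_of_ne h3 h4] at h2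

/-- Number of size 2 elements below `w`. -/
noncomputable def twos {X : Type u} (w : FactPair X) : ℕ :=
  Nat.card {p : FactPair X // FactLE p w ∧ sz p = 2}

theorem twos_eq {X : Type u} (w : FactPair X) :
    twos w = Nat.card {t : FactPair (Quotient w.1.1) // sz t = 2} := by
  apply (Nat.card_eq_of_bijective
    (fun t : {t : FactPair (Quotient w.1.1) // sz t = 2} =>
      (⟨liftF w t.1, liftF_le w t.1, by rw [sz_liftF]; exact t.2⟩ :
        {p : FactPair X // FactLE p w ∧ sz p = 2})) ?_).symm
  constructor
  · rintro ⟨s, hs⟩ ⟨t, ht⟩ h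
    exact Subtype.ext (liftF_injective w (congrArg Subtype.val h))
  · rintro ⟨p, hp, hp2⟩
    obtain ⟨t, rfl⟩ := liftF_surj hp
    exact ⟨⟨t, by rw [← sz_liftF w]; exact hp2⟩, rfl⟩

theorem sz_ne_zero_iff {X : Type u} [Nonempty X] (w : FactPair X) :
    sz w ≠ 0 ↔ Finite (Quotient w.1.1) := by
  constructor
  · exact Nat.finite_of_card_ne_zero
  · intro h
    have : Nonempty (Quotient w.1.1) := (inferInstance : Nonempty X).map (Quotient.mk _)
    exact Nat.card_pos.ne'

theorem twos_zero_of_sz_zero {X : Type u} [Nonempty X] (w : FactPair X) (h : sz w = 0) :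
    twos w = 0 := by
  have h1 : Infinite (Quotient w.1.1) := by
    by_contra h2
    exact (sz_ne_zero_iff w).2 (not_infinite_iff_finite.1 h2) h
  have := infinite_two (Y := Quotient w.1.1)
  rw [twos_eq]
  exact Nat.card_eq_zero_of_infinite

theorem twos_even {X : Type u} (w : FactPair X) (k : ℕ) (hk : 0 < k) (h : sz w = 2 * k) :
    twos w * 2 = Nat.centralBinom k * k.factorial := by
  have h1 := card_type (Y := Quotient w.1.1) (a := 2) (b := k) h (by norm_num) hk
  rw [← twos_eq] at h1
  have h2 : (2 * k).factorial = Nat.centralBinom k * k.factorial * k.factorial := by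
    have := Nat.choose_mul_factorial_mul_factorial (n := 2 * k) (k := k) (by omega)
    rw [show 2 * k - k = k by omega] at this
    rw [← this, Nat.centralBinom]
  rw [h2] at h1
  have h3 : (twos w * 2) * k.factorial = (Nat.centralBinom k * k.factorial) * k.factorial := by
    rw [← h1]; simp [Nat.factorial]; ring
  exact Nat.eq_of_mul_eq_mul_right (Nat.factorial_pos k) h3

theorem even_of_twos {X : Type u} [Nonempty X] (w : FactPair X) (h : twos w ≠ 0) :
    ∃ k, 0 < k ∧ sz w = 2 * k := by
  have h0 : sz w ≠ 0 := fun h' => h (twos_zero_of_sz_zero w h')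
  have hne : Nonempty {p : FactPair X // FactLE p w ∧ sz p = 2} :=
    (Nat.card_ne_zero.1 h).1
  obtain ⟨p, hp, hp2⟩ := hne
  obtain ⟨k, hk, -⟩ := sz_mul_of_le hp
  rw [hp2] at hk
  exact ⟨k, by omega, hk.symm⟩

theorem sz_eq_of_twos {X : Type u} [Nonempty X] (w w' : FactPair X) (h : twos w = twos w')
    (k : ℕ) (hk : 0 < k) (hw : sz w = 2 * k) : sz w' = sz w := by
  have h1 := twos_even w k hk hw
  have hpos : ∀ k, 0 < Nat.centralBinom k * k.factorial := fun k =>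
    Nat.mul_pos (Nat.centralBinom_pos k) (Nat.factorial_pos k)
  have h0 : twos w' ≠ 0 := by
    intro h2
    rw [h, h2] at h1
    have := hpos k
    omega
  obtain ⟨k', hk', hw'⟩ := even_of_twos w' h0
  have h2 := twos_even w' k' hk' hw'
  rw [← h, h1] at h2
  have hm : ∀ a b : ℕ, a < b → 0 < a → Nat.centralBinom a * a.factorial <
      Nat.centralBinom b * b.factorial := by
    intro a b hab ha
    exact Nat.mul_lt_mul_of_le_of_lt (Nat.centralBinom_strictMono.monotone hab.le)
      ((Nat.factorial_lt ha).2 hab) (Nat.centralBinom_pos _)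
  rcases lt_trichotomy k k' with h3 | h3 | h3
  · have := hm _ _ h3 hk; omega
  · rw [hw, hw', h3]
  · have := hm _ _ h3 hk'; omega

theorem mkE_le {X : Type u} {A C B : Type*} (e : X ≃ A × (C × B)) :
    FactLE (mkE e) (mkE (e.trans (Equiv.prodAssoc A C B).symm)) := by
  refine ⟨?_, ?_, ?_⟩
  · intro x y h
    have h' : ((e x).1, (e x).2.1) = ((e y).1, (e y).2.1) := h
    have h2 := congrArg Prod.fst h'
    exact h2
  · intro x y h
    have h' : (e x).2 = (e y).2 := h
    have h2 := congrArg Prod.snd h'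
    exact h2
  · funext x y
    apply propext
    have key : ∀ x y, Relation.Comp (mkE (e.trans (Equiv.prodAssoc A C B).symm)).1.1
        (mkE e).1.2 x y ↔ (e x).2.1 = (e y).2.1 := by
      intro x y
      constructor
      · rintro ⟨z, h1, h2⟩
        exact (congrArg Prod.snd h1).trans (congrArg Prod.fst h2)
      · intro h
        refine ⟨e.symm ((e x).1, (e y).2), ?_, ?_⟩
        · rw [mkE_fst]
          simp [h]
        · rw [mkE_snd]
          simp
    rw [key]
    constructor
    · intro h
      obtain ⟨z, h1, h2⟩ := (key y x).2 h.symm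
      exact ⟨z, Setoid.symm' _ h2, Setoid.symm' _ h1⟩
    · rintro ⟨z, h1, h2⟩
      exact ((key y x).1 ⟨z, Setoid.symm' _ h2, Setoid.symm' _ h1⟩).symm

theorem exists_above {X : Type u} [Infinite X] (a : FactPair X) (n k : ℕ) (hn : 0 < n)
    (hk : 0 < k) (ha : sz a = n) : ∃ w, FactLE a w ∧ sz w = n * k := by
  have hf : Finite (Quotient a.1.1) := Nat.finite_of_card_ne_zero (by
    change sz a ≠ 0; omega)
  have hi : Infinite (Quotient a.1.2) := by
    by_contra h
    have := not_infinite_iff_finite.1 h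
    have : Finite X := Finite.of_equiv _ (prodEquiv a.2).symm
    exact not_finite X
  have hc : Nonempty (Quotient a.1.2 ≃ Fin k × Quotient a.1.2) := by
    have : Nonempty (Fin k) := ⟨⟨0, hk⟩⟩
    apply Cardinal.eq.1
    simp only [Cardinal.mk_prod, Cardinal.lift_id, Cardinal.lift_uzero]
    exact (Cardinal.mul_eq_right (Cardinal.aleph0_le_mk _)
      ((Cardinal.lt_aleph0_of_finite _).le.trans (Cardinal.aleph0_le_mk _)) (by simp; omega)).symm
  obtain ⟨g⟩ := hc
  let f : Quotient a.1.1 ≃ Fin n := Finite.equivFinOfCardEq ha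
  let e : X ≃ Fin n × (Fin k × Quotient a.1.2) := (prodEquiv a.2).trans (Equiv.prodCongr f g)
  have hae : mkE e = a := mkE_prodEquiv a f g
  have : Nonempty (Quotient a.1.2) := inferInstance
  refine ⟨mkE (e.trans (Equiv.prodAssoc _ _ _).symm), ?_, ?_⟩
  · have h := mkE_le e
    rwa [hae] at h
  · rw [sz_mkE]; simp

theorem sz_two_iff {X : Type u} [Infinite X] (a : FactPair X) :
    sz a = 2 ↔ (¬ ∀ p, FactLE a p) ∧ ∃ w, FactLE a w ∧ a ≠ w ∧
      0 < Nat.card {p // FactLE p w} ∧ Nat.card {p // FactLE p w} ≤ 8 := by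
  rw [← sz_eq_one_iff]
  constructor
  · intro h
    refine ⟨by omega, ?_⟩
    obtain ⟨w, hw, hw4⟩ := exists_above a 2 2 (by norm_num) (by norm_num) h
    refine ⟨w, hw, ?_, ?_⟩
    · rintro rfl; omega
    · rw [← Nat.card_congr (intervalEquiv w)]
      exact card_four hw4
  · rintro ⟨h1, w, hw, hne, hpos, hle⟩
    rw [← Nat.card_congr (intervalEquiv w)] at hpos hle
    have hfin : Finite (FactPair (Quotient w.1.1)) := Nat.finite_of_card_ne_zero hpos.ne'
    have hw0 : sz w ≠ 0 := by
      rw [sz_ne_zero_iff]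
      by_contra h2
      have := not_finite_iff_infinite.1 h2
      have := infinite_two (Y := Quotient w.1.1)
      exact not_finite {t : FactPair (Quotient w.1.1) // sz t = 2}
    obtain ⟨k, hk, hk1⟩ := sz_mul_of_le hw
    have hk0 : k ≠ 0 := by rintro rfl; simp at hk; omega
    have hk2 : 2 ≤ k := by
      by_contra h2
      exact hne (hk1 (by omega))
    have ha0 : sz a ≠ 0 := by intro h; rw [h] at hk; simp at hk; omega
    by_contra h2
    have ha3 : 3 ≤ sz a := by omega
    have hc := card_type (Y := Quotient w.1.1) (a := sz a) (b := k) hk.symm (by omega) (by omega)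
    have hb := factorial_bound (sz a) k ha3 hk2
    have hle' : Nat.card {t : FactPair (Quotient w.1.1) // sz t = sz a} ≤
        Nat.card (FactPair (Quotient w.1.1)) := Nat.card_le_card_of_injective _ Subtype.val_injective
    have : Nat.card {t : FactPair (Quotient w.1.1) // sz t = sz a} *
        ((sz a).factorial * k.factorial) ≤ 8 * ((sz a).factorial * k.factorial) :=
      Nat.mul_le_mul_right _ (hle'.trans hle)
    omega

theorem sz_two_map {X : Type u} [Infinite X] (e : FactPair X ≃ FactPair X)
    (he : ∀ p q, FactLE p q ↔ FactLE (e p) (e q)) (a : FactPair X) :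
    sz (e a) = 2 ↔ sz a = 2 := by
  have key : ∀ (e : FactPair X ≃ FactPair X) (_ : ∀ p q, FactLE p q ↔ FactLE (e p) (e q))
      (a : FactPair X), sz a = 2 → sz (e a) = 2 := by
    intro e he a h
    rw [sz_two_iff] at h ⊢
    obtain ⟨h1, w, hw, hne, h3⟩ := h
    refine ⟨fun h => h1 fun p => (he a p).2 (h (e p)), e w, (he _ _).1 hw,
      fun h => hne (e.injective h), ?_⟩
    rw [← Nat.card_congr (e.subtypeEquiv (p := fun p => FactLE p w)
      (q := fun p => FactLE p (e w)) fun p => he p w)]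
    exact h3
  refine ⟨fun h => ?_, key e he a⟩
  have := key e.symm (fun p q => by rw [he (e.symm p)]; simp) (e a) h
  simpa using this

theorem twos_map {X : Type u} [Infinite X] (e : FactPair X ≃ FactPair X)
    (he : ∀ p q, FactLE p q ↔ FactLE (e p) (e q)) (a : FactPair X) :
    twos (e a) = twos a := by
  unfold twos
  exact (Nat.card_congr (e.subtypeEquiv fun p => by rw [sz_two_map e he, he])).symm

theorem sz_even_map {X : Type u} [Infinite X] (e : FactPair X ≃ FactPair X)
    (he : ∀ p q, FactLE p q ↔ FactLE (e p) (e q)) (a : FactPair X) (k : ℕ) (hk : 0 < k)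
    (h : sz a = 2 * k) : sz (e a) = 2 * k := by
  rw [← h]
  exact sz_eq_of_twos a (e a) (twos_map e he a).symm k hk h

theorem sz_map_dvd {X : Type u} [Infinite X] (e : FactPair X ≃ FactPair X)
    (he : ∀ p q, FactLE p q ↔ FactLE (e p) (e q)) (a : FactPair X) (n : ℕ) (hn : 0 < n)
    (h : sz a = n) : sz (e a) ∣ 2 * n := by
  obtain ⟨w, hw, hw2⟩ := exists_above a n 2 hn (by norm_num) h
  have h1 := sz_even_map e he w n hn (by omega)
  obtain ⟨k, hk, -⟩ := sz_mul_of_le ((he _ _).1 hw)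
  exact ⟨k, by omega⟩

theorem sz_map {X : Type u} [Infinite X] (e : FactPair X ≃ FactPair X)
    (he : ∀ p q, FactLE p q ↔ FactLE (e p) (e q)) (a : FactPair X) (n : ℕ) (hn : 0 < n)
    (h : sz a = n) : sz (e a) = n := by
  have he' : ∀ p q, FactLE p q ↔ FactLE (e.symm p) (e.symm q) := fun p q => by
    rw [he (e.symm p)]; simp
  have h1 := sz_map_dvd e he a n hn h
  have h0 : 0 < sz (e a) := Nat.pos_of_dvd_of_pos h1 (by omega)
  have h2 := sz_map_dvd e.symm he' (e a) _ h0 rfl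
  rw [Equiv.symm_apply_apply, h] at h2
  rcases Nat.even_or_odd' n with ⟨k, hk | hk⟩
  · rw [hk]; exact sz_even_map e he a k (by omega) (by omega)
  rcases Nat.even_or_odd' (sz (e a)) with ⟨j, hj | hj⟩
  · have := sz_even_map e.symm he' (e a) j (by omega) hj
    rw [Equiv.symm_apply_apply, h] at this
    omega
  · have c1 : Nat.Coprime (sz (e a)) 2 := by rw [hj]; simp
    have c2 : Nat.Coprime n 2 := by rw [hk]; simp
    exact Nat.dvd_antisymm (c1.dvd_of_dvd_mul_left h1) (c2.dvd_of_dvd_mul_left h2)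

theorem exists_compl {X : Type u} (θ : Setoid X) (n : ℕ) (hn : 0 < n) (h : IsNRel n θ) :
    ∃ t : FactPair X, t.1.1 = θ := by
  have hq : ∀ q : Quotient θ, Nonempty ({x : X // Quotient.mk θ x = q} ≃ Fin n) := by
    intro q
    induction q using Quotient.inductionOn with | _ x => ?_
    have h1 : Nat.card {y : X // Quotient.mk θ y = Quotient.mk θ x} = n := by
      rw [← h x]
      apply Nat.card_congr
      apply Equiv.subtypeEquivRight
      intro y
      exact ⟨fun h => θ.symm' (Quotient.exact h), fun h => Quotient.sound (θ.symm' h)⟩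
    have : Finite {y : X // Quotient.mk θ y = Quotient.mk θ x} :=
      Nat.finite_of_card_ne_zero (by omega)
    exact ⟨Finite.equivFinOfCardEq h1⟩
  let E := fun q => (hq q).some
  let e : X ≃ Quotient θ × Fin n :=
    ((Equiv.sigmaFiberEquiv (Quotient.mk θ)).symm.trans (Equiv.sigmaCongrRight E)).trans
      (Equiv.sigmaEquivProd _ _)
  refine ⟨mkE e, ?_⟩
  apply Setoid.ext
  intro x y
  rw [mkE_fst]
  exact Quotient.eq

theorem descend {X : Type u} [Nonempty X] (θ φ : Setoid X) (m n : ℕ) (hm : 0 < m)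
    (hθ : IsNRel m θ) (hφ : IsNRel n φ) (hle : θ ≤ φ) :
    ∃ w : FactPair X, w.1.1 = θ ∧ ∃ P : Setoid (Quotient w.1.1),
      (∀ x y, P (Quotient.mk _ x) (Quotient.mk _ y) ↔ φ x y) ∧
      ∀ c, Nat.card {d // P c d} * m = n := by
  obtain ⟨w, rfl⟩ := exists_compl θ m hm hθ
  refine ⟨w, rfl, Setoid.comap Quotient.out φ, ?_⟩
  have hout : ∀ x, φ (Quotient.mk w.1.1 x).out x :=
    fun x => hle (Quotient.exact (Quotient.out_eq _))
  have hP : ∀ x y, (Setoid.comap Quotient.out φ) (Quotient.mk w.1.1 x) (Quotient.mk w.1.1 y) ↔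
      φ x y := by
    intro x y
    constructor
    · intro h
      exact φ.trans' (φ.symm' (hout x)) (φ.trans' h (hout y))
    · intro h
      exact φ.trans' (hout x) (φ.trans' h (φ.symm' (hout y)))
  refine ⟨hP, ?_⟩
  intro c
  induction c using Quotient.inductionOn with | _ x => ?_
  have hm' : Nat.card (Quotient w.1.2) = m := (isNRel_fst_iff w m).1 hθ
  rw [← hφ x, ← hm', ← Nat.card_prod]
  symm
  apply Nat.card_eq_of_bijective (fun y : {y // φ x y} =>
    ((⟨Quotient.mk w.1.1 y.1, (hP _ _).2 y.2⟩, Quotient.mk w.1.2 y.1) :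
      {d // (Setoid.comap Quotient.out φ) (Quotient.mk w.1.1 x) d} × Quotient w.1.2))
  constructor
  · rintro ⟨y, hy⟩ ⟨z, hz⟩ h
    have h1 := congrArg (fun p => p.1.1) h
    have h2 := congrArg Prod.snd h
    exact Subtype.ext ((w.2.1 y z).1 ⟨Quotient.exact h1, Quotient.exact h2⟩)
  · rintro ⟨⟨d, hd⟩, q⟩
    obtain ⟨y, hy⟩ := (prodEquiv w.2).surjective (d, q)
    rw [prodEquiv_apply] at hy
    obtain ⟨rfl, rfl⟩ := Prod.mk.inj hy
    exact ⟨⟨y, (hP _ _).1 hd⟩, rfl⟩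

theorem nrel_dvd {X : Type u} [Nonempty X] (θ φ : Setoid X) (m n : ℕ) (hm : 0 < m)
    (hθ : IsNRel m θ) (hφ : IsNRel n φ) (hle : θ ≤ φ) : m ∣ n := by
  obtain ⟨w, -, P, -, h⟩ := descend θ φ m n hm hθ hφ hle
  obtain ⟨x⟩ := ‹Nonempty X›
  exact ⟨_, by rw [mul_comm]; exact (h (Quotient.mk _ x)).symm⟩

theorem exists_le_pair {X : Type u} [Nonempty X] (θ φ : Setoid X) (m n : ℕ) (hm : 0 < m)
    (hn : 0 < n) (hθ : IsNRel m θ) (hφ : IsNRel n φ) (hle : θ ≤ φ) :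
    ∃ s t : FactPair X, t.1.1 = θ ∧ s.1.1 = φ ∧ FactLE s t := by
  obtain ⟨w, rfl, P, hP, h⟩ := descend θ φ m n hm hθ hφ hle
  have hd : ∀ c, Nat.card {d // P c d} = n / m := fun c => by
    rw [← h c, Nat.mul_div_cancel _ hm]
  have hpos : 0 < n / m := by
    obtain ⟨x⟩ := ‹Nonempty X›
    rw [← hd (Quotient.mk _ x)]
    apply Nat.pos_of_ne_zero
    intro h0
    have := h (Quotient.mk _ x)
    rw [h0] at this
    omega
  obtain ⟨t, ht⟩ := exists_compl P (n / m) hpos hd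
  refine ⟨liftF w t, w, rfl, ?_, liftF_le w t⟩
  apply Setoid.ext
  intro x y
  rw [liftF_fst, ht]
  exact hP x y

theorem core {X : Type u} [Nonempty X] (n : ℕ) (hn : 0 < n) (a b w d : FactPair X)
    (hb : sz b = n) (hw : sz w = n * 2) (hd : sz d = n * 3)
    (haw : FactLE a w) (hbw : FactLE b w) (had : FactLE a d) (hbd : FactLE b d) :
    a.1.2 ≤ b.1.2 := by
  by_contra hne
  obtain ⟨u0, v0, hu, hv⟩ : ∃ u v, a.1.2 u v ∧ ¬ b.1.2 u v := by
    by_contra h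
    push Not at h
    exact hne fun {x y} hxy => h x y hxy
  have hwd : w.1.2 ≤ d.1.2 := by
    obtain ⟨s, rfl⟩ := liftF_surj hbw
    obtain ⟨t, rfl⟩ := liftF_surj haw
    have hcard : Nat.card (Quotient s.1.2) = 2 := by
      have h1 : sz s * sz (FactPerp s) = sz w := sz_mul s
      rw [sz_liftF] at hb
      rw [hb, hw] at h1
      exact Nat.eq_of_mul_eq_mul_left hn h1
    have hfin : Finite (Quotient s.1.2) := Nat.finite_of_card_ne_zero (by omega)
    let f : Quotient s.1.2 ≃ Fin 2 := Finite.equivFinOfCardEq hcard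
    have huw : w.1.2 u0 v0 := hu.2
    have hs : ¬ s.1.2 (Quotient.mk _ u0) (Quotient.mk _ v0) := fun h => hv ⟨h, huw⟩
    have hcase : ∀ c, s.1.2 c (Quotient.mk _ u0) ∨ s.1.2 c (Quotient.mk _ v0) := by
      intro c
      by_contra hc
      push Not at hc
      have h1 : f (Quotient.mk _ (Quotient.mk _ u0)) ≠ f (Quotient.mk _ (Quotient.mk _ v0)) :=
        fun h => hs (Quotient.exact (f.injective h))
      have h2 : f (Quotient.mk _ c) ≠ f (Quotient.mk _ (Quotient.mk _ u0)) :=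
        fun h => hc.1 (Quotient.exact (f.injective h))
      have h3 : f (Quotient.mk _ c) ≠ f (Quotient.mk _ (Quotient.mk _ v0)) :=
        fun h => hc.2 (Quotient.exact (f.injective h))
      omega
    intro u v huv
    obtain ⟨z1, hz1, hz1'⟩ := w.2.2 u0 u
    obtain ⟨z2, hz2, hz2'⟩ := w.2.2 v0 u
    have e1 : Quotient.mk w.1.1 u0 = Quotient.mk w.1.1 z1 := Quotient.sound hz1
    have e2 : Quotient.mk w.1.1 v0 = Quotient.mk w.1.1 z2 := Quotient.sound hz2
    have hz12 : d.1.2 z1 z2 := by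
      apply had.2.1
      refine ⟨?_, w.1.2.trans' hz1' (w.1.2.symm' hz2')⟩
      have h := hu.1
      change t.1.2 (Quotient.mk w.1.1 u0) (Quotient.mk w.1.1 v0) at h
      rw [e1, e2] at h
      exact h
    have key : ∀ x, w.1.2 u x → d.1.2 x z1 := by
      intro x hx
      rcases hcase (Quotient.mk _ x) with h | h
      · rw [e1] at h
        exact hbd.2.1 ⟨h, w.1.2.trans' (w.1.2.symm' hx) (w.1.2.symm' hz1')⟩
      · rw [e2] at h
        exact d.1.2.trans' (hbd.2.1 ⟨h, w.1.2.trans' (w.1.2.symm' hx) (w.1.2.symm' hz2')⟩)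
          (d.1.2.symm' hz12)
    exact d.1.2.trans' (key u (w.1.2.refl' u)) (d.1.2.symm' (key v huv))
  have := nrel_dvd w.1.2 d.1.2 (n * 2) (n * 3) (by omega) ((isNRel_snd_iff _ _).2 hw)
    ((isNRel_snd_iff _ _).2 hd) hwd
  have := Nat.dvd_of_mul_dvd_mul_left hn this
  omega

theorem mkE_congr {X : Type u} {A B A' B' : Type*} (e : X ≃ A × B) (e' : X ≃ A' × B')
    (h1 : ∀ x y, (e x).1 = (e y).1 ↔ (e' x).1 = (e' y).1)
    (h2 : ∀ x y, (e x).2 = (e y).2 ↔ (e' x).2 = (e' y).2) : mkE e = mkE e' :=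
  FactPair.ext' h1 h2

/-- Relabelling of the first coordinate depending on the second. -/
def act {N Z : Type*} (τ : Z → Equiv.Perm N) : N × Z ≃ N × Z where
  toFun p := (τ p.2 p.1, p.2)
  invFun p := ((τ p.2).symm p.1, p.2)
  left_inv p := by simp
  right_inv p := by simp

theorem act_apply {N Z : Type*} (τ : Z → Equiv.Perm N) (p : N × Z) :
    act τ p = (τ p.2 p.1, p.2) := rfl

theorem move_bound {X : Type u} {N Z K Y : Type*} [Nonempty Y] (e : X ≃ N × Z) (κ : Z ≃ K × Y)
    (τ : K → Equiv.Perm N) :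
    ∃ w, FactLE (mkE e) w ∧ FactLE (mkE (e.trans (act fun z => τ (κ z).1))) w ∧
      sz w = Nat.card N * Nat.card K := by
  have hr : ∀ e : X ≃ N × Z, mkE (e.trans (Equiv.prodCongr (Equiv.refl N) κ)) = mkE e := by
    intro e
    apply mkE_congr
    · intro x y; simp
    · intro x y; simp
  let e1 := e.trans (Equiv.prodCongr (Equiv.refl N) κ)
  let e2 := (e.trans (act fun z => τ (κ z).1)).trans (Equiv.prodCongr (Equiv.refl N) κ)
  have hw : mkE (e1.trans (Equiv.prodAssoc N K Y).symm) =
      mkE (e2.trans (Equiv.prodAssoc N K Y).symm) := by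
    apply mkE_congr
    · intro x y
      simp only [e1, e2, Equiv.trans_apply, Equiv.prodCongr_apply, act_apply, Prod.map,
        Equiv.prodAssoc_symm_apply, Prod.mk.injEq, Equiv.refl_apply]
      constructor
      · rintro ⟨h1, h2⟩
        exact ⟨by rw [h1, h2], h2⟩
      · rintro ⟨h1, h2⟩
        refine ⟨?_, h2⟩
        rw [h2] at h1
        exact (τ _).injective h1
    · intro x y
      simp [e1, e2, act_apply]
  refine ⟨mkE (e1.trans (Equiv.prodAssoc N K Y).symm), ?_, ?_, ?_⟩
  · have h := mkE_le e1
    rwa [hr] at h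
  · have h := mkE_le e2
    rw [hr] at h
    rwa [hw]
  · rw [sz_mkE, Nat.card_prod]

theorem balanced {Z : Type u} [Infinite Z] {K : Type} [Finite K] (T : Set Z)
    (hT : Cardinal.mk T = Cardinal.mk Z) (hT' : Cardinal.mk (Tᶜ : Set Z) = Cardinal.mk Z)
    (c : K → Prop) (k1 k2 : K) (hk1 : c k1) (hk2 : ¬ c k2) :
    ∃ κ : Z ≃ K × Z, ∀ z, z ∈ T ↔ c (κ z).1 := by
  classical
  have hKZ : Cardinal.mk (K × Z) = Cardinal.mk Z := by
    simp only [Cardinal.mk_prod, Cardinal.lift_id, Cardinal.lift_uzero]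
    refine Cardinal.mul_eq_right (Cardinal.aleph0_le_mk _)
      (le_trans (le_of_lt ?_) (Cardinal.aleph0_le_mk _)) ?_
    · simpa using Cardinal.lt_aleph0_of_finite K
    · have : Nonempty K := ⟨k1⟩
      simp
  have h1 : Cardinal.mk {p : K × Z // c p.1} = Cardinal.mk Z := by
    apply le_antisymm
    · rw [← hKZ]; exact Cardinal.mk_subtype_le _
    · exact Cardinal.mk_le_of_injective (f := fun z : Z => (⟨(k1, z), hk1⟩ : {p : K × Z // c p.1}))
        (fun x y h => congrArg (fun p => p.1.2) h)
  have h2 : Cardinal.mk {p : K × Z // ¬ c p.1} = Cardinal.mk Z := by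
    apply le_antisymm
    · rw [← hKZ]; exact Cardinal.mk_subtype_le _
    · exact Cardinal.mk_le_of_injective
        (f := fun z : Z => (⟨(k2, z), hk2⟩ : {p : K × Z // ¬ c p.1}))
        (fun x y h => congrArg (fun p => p.1.2) h)
  obtain ⟨f⟩ := Cardinal.eq.1 (hT.trans h1.symm)
  obtain ⟨g⟩ := Cardinal.eq.1 (hT'.trans h2.symm)
  have g' : {z // ¬ z ∈ T} ≃ {p : K × Z // ¬ c p.1} := g
  have f' : {z // z ∈ T} ≃ {p : K × Z // c p.1} := f
  refine ⟨(Equiv.sumCompl (fun z => z ∈ T)).symm.trans ((Equiv.sumCongr f' g').trans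
    (Equiv.sumCompl (fun p : K × Z => c p.1))), ?_⟩
  intro z
  by_cases hz : z ∈ T
  · simp only [hz, true_iff, Equiv.trans_apply, Equiv.sumCompl_symm_apply_of_pos hz,
      Equiv.sumCongr_apply, Sum.map_inl, Equiv.sumCompl_apply_inl]
    exact (f' _).2
  · simp only [hz, false_iff, Equiv.trans_apply, Equiv.sumCompl_symm_apply_of_neg hz,
      Equiv.sumCongr_apply, Sum.map_inr, Equiv.sumCompl_apply_inr]
    exact (g' _).2

/-- The group of relabellings not changing `F`. -/
def moveGroup {X : Type u} {N Z : Type*} (F : FactPair X → Setoid X) :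
    Subgroup (Z → Equiv.Perm N) where
  carrier := {τ | ∀ e : X ≃ N × Z, F (mkE e) = F (mkE (e.trans (act τ)))}
  one_mem' := fun e => by
    congr 1
  mul_mem' := by
    intro σ τ hσ hτ e
    rw [hτ e, hσ (e.trans (act τ))]
    rfl
  inv_mem' := by
    intro τ hτ e
    rw [hτ (e.trans (act τ⁻¹))]
    congr 1
    apply mkE_congr
    · intro x y; simp [act_apply]
    · intro x y; simp [act_apply]

theorem mem_moveGroup {X : Type u} {N Z : Type*} (F : FactPair X → Setoid X)
    (τ : Z → Equiv.Perm N) : τ ∈ moveGroup F ↔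
      ∀ e : X ≃ N × Z, F (mkE e) = F (mkE (e.trans (act τ))) := Iff.rfl

open Classical in
theorem single_mem {X Z : Type u} [Infinite Z] (n : ℕ) (F : FactPair X → Setoid X)
    (hF : ∀ a b w d, sz a = n → sz b = n → sz w = n * 2 → sz d = n * 3 → FactLE a w →
      FactLE b w → FactLE a d → FactLE b d → F a = F b) (T : Set Z)
    (hT : Cardinal.mk T = Cardinal.mk Z) (hT' : Cardinal.mk (Tᶜ : Set Z) = Cardinal.mk Z)
    (σ : Equiv.Perm (Fin n)) :
    (fun z => if z ∈ T then σ else 1) ∈ moveGroup (X := X) (N := Fin n) (Z := Z) F := by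
  rw [mem_moveGroup]
  intro e
  obtain ⟨κ2, h2⟩ := balanced (K := Fin 2) T hT hT' (fun k => k = 0) 0 1 rfl (by decide)
  obtain ⟨κ3, h3⟩ := balanced (K := Fin 3) T hT hT' (fun k => k = 0) 0 1 rfl (by decide)
  have e2 : (fun z => if z ∈ T then σ else 1) =
      fun z => (fun k : Fin 2 => if k = 0 then σ else 1) (κ2 z).1 := by
    funext z; simp only [h2]
  have e3 : (fun z => if z ∈ T then σ else 1) =
      fun z => (fun k : Fin 3 => if k = 0 then σ else 1) (κ3 z).1 := by
    funext z; simp only [h3]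
  obtain ⟨w, hw1, hw2, hw3⟩ := move_bound e κ2 (fun k : Fin 2 => if k = 0 then σ else 1)
  obtain ⟨d, hd1, hd2, hd3⟩ := move_bound e κ3 (fun k : Fin 3 => if k = 0 then σ else 1)
  rw [← e2] at hw2
  rw [← e3] at hd2
  refine hF _ _ w d ?_ ?_ ?_ ?_ hw1 hw2 hd1 hd2
  · rw [sz_mkE]; simp
  · rw [sz_mkE]; simp
  · rw [hw3]; simp
  · rw [hd3]; simp

open Classical in
theorem all_mem {X Z : Type u} [Infinite Z] (n : ℕ) (F : FactPair X → Setoid X)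
    (hF : ∀ a b w d, sz a = n → sz b = n → sz w = n * 2 → sz d = n * 3 → FactLE a w →
      FactLE b w → FactLE a d → FactLE b d → F a = F b) (τ : Z → Equiv.Perm (Fin n)) :
    τ ∈ moveGroup (X := X) (N := Fin n) (Z := Z) F := by
  obtain ⟨κ⟩ : Nonempty (Z ≃ Fin 3 × Z) := by
    apply Cardinal.eq.1
    simp only [Cardinal.mk_prod, Cardinal.lift_id, Cardinal.lift_uzero]
    exact (Cardinal.mul_eq_right (Cardinal.aleph0_le_mk _)
      ((Cardinal.lt_aleph0_of_finite _).le.trans (Cardinal.aleph0_le_mk _)) (by simp)).symm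
  have hbig : ∀ (T : Set Z) (i : Fin 3), (∀ z, (κ z).1 = i → z ∈ T) →
      Cardinal.mk T = Cardinal.mk Z := by
    intro T i h
    apply le_antisymm (Cardinal.mk_set_le _)
    refine Cardinal.mk_le_of_injective
      (f := fun z : Z => (⟨κ.symm (i, z), h _ (by simp)⟩ : T)) ?_
    intro x y hxy
    have := κ.symm.injective (congrArg Subtype.val hxy)
    exact congrArg Prod.snd this
  have hone : ∀ (T : Set Z) (i : Fin 3) (σ : Equiv.Perm (Fin n)), (∀ z ∈ T, (κ z).1 = i) →
      (fun z => if z ∈ T then σ else 1) ∈ moveGroup (X := X) (N := Fin n) (Z := Z) F := by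
    intro T i σ hT
    have hi1 : i + 1 ≠ i := (by decide : ∀ i : Fin 3, i + 1 ≠ i) i
    have hi2 : i + 2 ≠ i := (by decide : ∀ i : Fin 3, i + 2 ≠ i) i
    have hi3 : i + 2 ≠ i + 1 := (by decide : ∀ i : Fin 3, i + 2 ≠ i + 1) i
    let U : Set Z := {z | (κ z).1 = i + 1}
    have hU := single_mem n F hF U (hbig U (i + 1) fun z hz => hz)
      (hbig Uᶜ (i + 2) fun z hz h => hi3 (hz.symm.trans h)) σ⁻¹
    have hTU := single_mem n F hF (T ∪ U) (hbig _ (i + 1) fun z hz => Or.inr hz)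
      (hbig _ (i + 2) fun z hz h => by
        rcases h with h | h
        · exact hi2 (hz.symm.trans (hT z h))
        · exact hi3 (hz.symm.trans h)) σ
    have := (moveGroup (X := X) (N := Fin n) (Z := Z) F).mul_mem hTU hU
    convert this using 1
    funext z
    by_cases h1 : z ∈ T
    · have h2 : z ∉ U := fun h => hi1 (Eq.trans (Eq.symm h) (hT z h1))
      simp [h1, h2]
    · by_cases h2 : z ∈ U
      · simp [h1, h2]
      · simp [h1, h2]
  have hind : ∀ s : Finset (Equiv.Perm (Fin n) × Fin 3),
      (fun z => if (τ z, (κ z).1) ∈ s then τ z else 1) ∈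
        moveGroup (X := X) (N := Fin n) (Z := Z) F := by
    intro s
    induction s using Finset.induction_on with
    | empty =>
      have := (moveGroup (X := X) (N := Fin n) (Z := Z) F).one_mem
      convert this using 1
      funext z
      simp
    | insert p s hp ih =>
      obtain ⟨σ, i⟩ := p
      have h1 := hone {z | τ z = σ ∧ (κ z).1 = i} i σ (fun z hz => hz.2)
      have := (moveGroup (X := X) (N := Fin n) (Z := Z) F).mul_mem h1 ih
      convert this using 1
      funext z
      by_cases h2 : τ z = σ ∧ (κ z).1 = i
      · obtain ⟨h3, h4⟩ := h2
        simp [h3, h4, hp]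
      · simp [h2, Finset.mem_insert, Prod.ext_iff]
  have := hind Finset.univ
  simpa using this

theorem same_snd {X : Type u} [Infinite X] (n : ℕ) (hn : 0 < n) (F : FactPair X → Setoid X)
    (hF : ∀ a b w d, sz a = n → sz b = n → sz w = n * 2 → sz d = n * 3 → FactLE a w →
      FactLE b w → FactLE a d → FactLE b d → F a = F b) (s t : FactPair X)
    (hs : sz s = n) (ht : sz t = n) (h : s.1.2 = t.1.2) : F s = F t := by
  obtain ⟨⟨s1, f⟩, hs2⟩ := s
  obtain ⟨⟨t1, f'⟩, ht2⟩ := t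
  change f = f' at h
  subst h
  have hs' : Nat.card (Quotient s1) = n := hs
  have ht' : Nat.card (Quotient t1) = n := ht
  have hfs : Finite (Quotient s1) := Nat.finite_of_card_ne_zero (by omega)
  have hft : Finite (Quotient t1) := Nat.finite_of_card_ne_zero (by omega)
  have hi : Infinite (Quotient f) := by
    by_contra h
    have := not_infinite_iff_finite.1 h
    have : Finite X := Finite.of_equiv _ (prodEquiv hs2).symm
    exact not_finite X
  let gs : Quotient s1 ≃ Fin n := Finite.equivFinOfCardEq hs'
  let gt : Quotient t1 ≃ Fin n := Finite.equivFinOfCardEq ht'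
  let es : X ≃ Fin n × Quotient f := (prodEquiv hs2).trans (Equiv.prodCongr gs (Equiv.refl _))
  let et : X ≃ Fin n × Quotient f := (prodEquiv ht2).trans (Equiv.prodCongr gt (Equiv.refl _))
  have hes : mkE es = ⟨(s1, f), hs2⟩ := mkE_prodEquiv ⟨(s1, f), hs2⟩ gs (Equiv.refl _)
  have het : mkE et = ⟨(t1, f), ht2⟩ := mkE_prodEquiv ⟨(t1, f), ht2⟩ gt (Equiv.refl _)
  have hes2 : ∀ x, (es x).2 = Quotient.mk f x := fun x => rfl
  have het2 : ∀ x, (et x).2 = Quotient.mk f x := fun x => rfl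
  have hinj : ∀ z, Function.Injective (fun i => (et (es.symm (i, z))).1) := by
    intro z i j hij
    have h2 : ∀ i, (et (es.symm (i, z))).2 = z := by
      intro i
      rw [het2, ← hes2, Equiv.apply_symm_apply]
    have h3 := et.injective (Prod.ext hij ((h2 i).trans (h2 j).symm))
    exact congrArg Prod.fst (es.symm.injective h3)
  let τ : Quotient f → Equiv.Perm (Fin n) := fun z =>
    Equiv.ofBijective _ (Finite.injective_iff_bijective.1 (hinj z))
  have hτ := (mem_moveGroup F τ).1 (all_mem n F hF τ) es
  rw [hes] at hτ
  rw [hτ, ← het]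
  congr 2
  apply Equiv.ext
  intro x
  apply Prod.ext
  · change (et (es.symm ((es x).1, (es x).2))).1 = _
    simp
  · change (es x).2 = _
    rw [hes2, het2]

theorem aut_nrel {X : Type u} [Infinite X] (α : FactPair X → FactPair X) (hα : IsFactAut α)
    (n : ℕ) (hn : 0 < n) (t : FactPair X) (h : IsNRel n t.1.1) : IsNRel n (α t).1.1 := by
  rw [isNRel_fst_iff] at h ⊢
  rw [← hα.2.2]
  exact sz_map (Equiv.ofBijective α hα.1) hα.2.1 _ n hn h

theorem aut_same_fst {X : Type u} [Infinite X] (α : FactPair X → FactPair X)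
    (hα : IsFactAut α) (n : ℕ) (hn : 0 < n) (s t : FactPair X) (hs : IsNRel n s.1.1)
    (h : s.1.1 = t.1.1) : (α s).1.1 = (α t).1.1 := by
  have ht : IsNRel n t.1.1 := h ▸ hs
  rw [isNRel_fst_iff] at hs ht
  have hz : ∀ a k, 0 < k → sz a = k → sz (α a) = k := fun a k hk hak =>
    sz_map (Equiv.ofBijective α hα.1) hα.2.1 a k hk hak
  have key := same_snd n hn (fun t => (α t).1.2) (by
    intro a b w d ha hb hw hd haw hbw had hbd
    have ha' := hz a n hn ha
    have hb' := hz b n hn hb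
    have hw' := hz w _ (by omega) hw
    have hd' := hz d _ (by omega) hd
    have e1 := (hα.2.1 _ _).1 haw
    have e2 := (hα.2.1 _ _).1 hbw
    have e3 := (hα.2.1 _ _).1 had
    have e4 := (hα.2.1 _ _).1 hbd
    exact le_antisymm (core n hn _ _ _ _ hb' hw' hd' e1 e2 e3 e4)
      (core n hn _ _ _ _ ha' hw' hd' e2 e1 e4 e3)) (FactPerp s) (FactPerp t) hs ht h
  simp only [hα.2.2] at key
  exact key

theorem aut_map {X : Type u} [Infinite X] (α : FactPair X → FactPair X) (hα : IsFactAut α) :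
    ∃ β : EqStar X → EqStar X,
      (∀ θ φ : EqStar X, θ.1 ≤ φ.1 → (β θ).1 ≤ (β φ).1) ∧
      (∀ n : ℕ, 0 < n → ∀ θ : EqStar X, (IsNRel n θ.1 → IsNRel n (β θ).1)) ∧
      (∀ (t : FactPair X) (θ : EqStar X), t.1.1 = θ.1 → (β θ).1 = (α t).1.1) := by
  have hc : ∀ θ : EqStar X, ∃ t : FactPair X, t.1.1 = θ.1 := by
    intro θ
    obtain ⟨n, hn, h⟩ := θ.2
    exact exists_compl θ.1 n hn h
  choose c hc using hc
  have h3 : ∀ (t : FactPair X) (θ : EqStar X), t.1.1 = θ.1 →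
      (α (c θ)).1.1 = (α t).1.1 := by
    intro t θ h
    obtain ⟨n, hn, hθ⟩ := θ.2
    exact aut_same_fst α hα n hn _ _ ((hc θ).symm ▸ hθ) ((hc θ).trans h.symm)
  refine ⟨fun θ => ⟨(α (c θ)).1.1, ?_⟩, ?_, ?_, ?_⟩
  · obtain ⟨n, hn, hθ⟩ := θ.2
    exact ⟨n, hn, aut_nrel α hα n hn _ ((hc θ).symm ▸ hθ)⟩
  · intro θ φ hle
    obtain ⟨m, hm, hθ⟩ := θ.2
    obtain ⟨n, hn, hφ⟩ := φ.2
    obtain ⟨s, t, ht, hs, hst⟩ := exists_le_pair θ.1 φ.1 m n hm hn hθ hφ hle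
    change (α (c θ)).1.1 ≤ (α (c φ)).1.1
    rw [h3 t θ ht, h3 s φ hs]
    exact ((hα.2.1 _ _).1 hst).1
  · intro n hn θ hθ
    exact aut_nrel α hα n hn _ ((hc θ).symm ▸ hθ)
  · intro t θ h
    exact h3 t θ h

theorem aut_symm {X : Type u} (α : FactPair X → FactPair X) (hα : IsFactAut α) :
    IsFactAut (Equiv.ofBijective α hα.1).symm := by
  have hr : ∀ p, α ((Equiv.ofBijective α hα.1).symm p) = p := fun p =>
    (Equiv.ofBijective α hα.1).apply_symm_apply p
  refine ⟨Equiv.bijective _, fun p q => ?_, fun p => ?_⟩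
  · have := hα.2.1 ((Equiv.ofBijective α hα.1).symm p) ((Equiv.ofBijective α hα.1).symm q)
    rw [hr, hr] at this
    exact this.symm
  · apply hα.1.1
    rw [hr, hα.2.2, hr]

end Aux

/-- Let `X` be infinite and `α` an automorphism of `Fact X`. Then there is an order
automorphism `β` of `Eq*(X)` such that (1) `θ` is an `n`-relation iff `β(θ)` is, and
(2) for every factor pair `(θ,θ')` with `θ ∈ Eq*(X)`, `β(θ)` is the first component of
`α(θ,θ')`. -/
theorem factAut_induces_eqStar_automorphism (X : Type*) [Infinite X]
    (α : FactPair X → FactPair X) (hα : IsFactAut α) :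
    ∃ β : EqStar X → EqStar X,
      Function.Bijective β ∧
      (∀ θ φ : EqStar X, θ.1 ≤ φ.1 ↔ (β θ).1 ≤ (β φ).1) ∧
      (∀ n : ℕ, 0 < n → ∀ θ : EqStar X, (IsNRel n θ.1 ↔ IsNRel n (β θ).1)) ∧
      (∀ (t : FactPair X) (ht : ∃ n : ℕ, 0 < n ∧ IsNRel n t.1.1),
        (β ⟨t.1.1, ht⟩).1 = (α t).1.1) := by
  obtain ⟨β, b1, b2, b3⟩ := aut_map α hα
  obtain ⟨γ, c1, c2, c3⟩ := aut_map _ (aut_symm α hα)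
  have hc : ∀ θ : EqStar X, ∃ t : FactPair X, t.1.1 = θ.1 := by
    intro θ
    obtain ⟨n, hn, h⟩ := θ.2
    exact exists_compl θ.1 n hn h
  have hl : ∀ θ, γ (β θ) = θ := by
    intro θ
    obtain ⟨t, ht⟩ := hc θ
    apply Subtype.ext
    rw [c3 (α t) (β θ) (b3 t θ ht).symm, ← ht]
    congr 2
    exact (Equiv.ofBijective α hα.1).symm_apply_apply t
  have hr : ∀ θ, β (γ θ) = θ := by
    intro θ
    obtain ⟨t, ht⟩ := hc θ
    apply Subtype.ext
    rw [b3 ((Equiv.ofBijective α hα.1).symm t) (γ θ) (c3 t θ ht).symm, ← ht]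
    congr 2
    exact (Equiv.ofBijective α hα.1).apply_symm_apply t
  refine ⟨β, Function.bijective_iff_has_inverse.2 ⟨γ, hl, hr⟩, fun θ φ => ⟨b1 θ φ, fun h => ?_⟩,
    fun n hn θ => ⟨b2 n hn θ, fun h => ?_⟩, fun t ht => b3 t _ rfl⟩
  · have := c1 _ _ h
    rwa [hl, hl] at this
  · have := c2 n hn _ h
    rwa [hl] at this
end

section
/- Let X be an infinite set and β an order automorphism of the poset Eq*(X) such that for every positive integer n and every θ ∈ Eq*(X), θ is an n-relation if and only if β(θ) is an n-relation. Then there is a permutation σ of X such that for every 2-relation π on X, β(π) = σ(π), i.e. β(π) = {(σ(x),σ(y)) : (x,y) ∈ π}. -/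
namespace EqS

/-- `Q` is a class of `θ`. -/
def Blk {X : Type*} (θ : Setoid X) (Q : Set X) : Prop := ∃ x, Q = {y | θ x y}

/-- `Z` is a union of classes of `θ`. -/
def Sat {X : Type*} (θ : Setoid X) (Z : Set X) : Prop := ∀ x y, θ x y → (x ∈ Z ↔ y ∈ Z)

section basics
variable {X : Type*}

lemma nrel_iff (n : ℕ) (θ : Setoid X) : IsNRel n θ ↔ ∀ x, {y | θ x y}.ncard = n := Iff.rfl

lemma two_fun {π : Setoid X} (h : IsNRel 2 π) : ∃ p : X → X, (∀ x, p x ≠ x) ∧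
    (∀ x, p (p x) = x) ∧ ∀ x y, π x y ↔ y = x ∨ y = p x := by
  have key : ∀ x, ∃ z, z ≠ x ∧ ∀ y, π x y ↔ y = x ∨ y = z := by
    intro x
    have h1 := (nrel_iff 2 π).1 h x
    obtain ⟨a, b, hab, hs⟩ := Set.ncard_eq_two.1 h1
    have hx : x ∈ {y | π x y} := π.refl' x
    have hm : ∀ y, π x y ↔ y = a ∨ y = b := fun y => by
      have : y ∈ {y | π x y} ↔ y ∈ ({a, b} : Set X) := by rw [hs]
      simpa using this
    rcases (hm x).1 hx with rfl | rfl
    · exact ⟨b, hab.symm, hm⟩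
    · exact ⟨a, hab, fun y => by rw [hm, or_comm]⟩
  choose p hp1 hp2 using key
  refine ⟨p, hp1, fun x => ?_, hp2⟩
  have h1 : π x (p x) := (hp2 x _).2 (Or.inr rfl)
  rcases (hp2 (p x) x).1 (π.symm' h1) with h2 | h2
  · exact absurd h2.symm (hp1 x)
  · exact h2.symm

/-- The setoid of an involution. -/
def inv (p : X → X) (hp : ∀ x, p (p x) = x) : Setoid X where
  r x y := y = x ∨ y = p x
  iseqv := by
    refine ⟨fun x => Or.inl rfl, ?_, ?_⟩
    · rintro x y (rfl | rfl)
      · exact Or.inl rfl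
      · exact Or.inr (hp x).symm
    · rintro x y z (rfl | rfl) (rfl | rfl)
      · exact Or.inl rfl
      · exact Or.inr rfl
      · exact Or.inr rfl
      · exact Or.inl (hp x)

lemma inv_nrel (p : X → X) (hp : ∀ x, p (p x) = x) (hf : ∀ x, p x ≠ x) : IsNRel 2 (inv p hp) := by
  rw [nrel_iff]
  intro x
  have : {y | inv p hp x y} = {x, p x} := by
    ext y; exact Iff.rfl
  rw [this, Set.ncard_pair (hf x).symm]

lemma ncard_four {a b c d : X} (h1 : a ≠ b) (h2 : a ≠ c) (h3 : a ≠ d) (h4 : b ≠ c) (h5 : b ≠ d)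
    (h6 : c ≠ d) : ({a, b, c, d} : Set X).ncard = 4 := by
  rw [Set.ncard_insert_of_notMem (by simp [*]), Set.ncard_insert_of_notMem (by simp [*]),
    Set.ncard_pair h6]

lemma four_cls {θ : Setoid X} (h : IsNRel 4 θ) {a b c d : X} (h1 : a ≠ b) (h2 : a ≠ c) (h3 : a ≠ d)
    (h4 : b ≠ c) (h5 : b ≠ d) (h6 : c ≠ d) (hb : θ a b) (hc : θ a c) (hd : θ a d) (z : X) :
    θ a z ↔ z = a ∨ z = b ∨ z = c ∨ z = d := by
  have hs : ({a, b, c, d} : Set X) ⊆ {y | θ a y} := by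
    rintro y (rfl | rfl | rfl | rfl)
    · exact θ.refl' _
    · exact hb
    · exact hc
    · exact hd
  have hc4 := (nrel_iff 4 θ).1 h a
  have hfin : {y | θ a y}.Finite := Set.finite_of_ncard_ne_zero (by omega)
  have := Set.eq_of_subset_of_ncard_le hs (by rw [hc4, ncard_four h1 h2 h3 h4 h5 h6]) hfin
  have h' : z ∈ ({a, b, c, d} : Set X) ↔ z ∈ {y | θ a y} := by rw [this]
  simpa using h'.symm

lemma four_of {θ : Setoid X} (h : ∀ a, ∃ b c d, a ≠ b ∧ a ≠ c ∧ a ≠ d ∧ b ≠ c ∧ b ≠ d ∧ c ≠ d ∧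
    ∀ z, θ a z ↔ z = a ∨ z = b ∨ z = c ∨ z = d) : IsNRel 4 θ := by
  rw [nrel_iff]
  intro a
  obtain ⟨b, c, d, h1, h2, h3, h4, h5, h6, hz⟩ := h a
  have : {y | θ a y} = {a, b, c, d} := by
    ext z; simpa using hz z
  rw [this, ncard_four h1 h2 h3 h4 h5 h6]

lemma Blk.mem {θ : Setoid X} {Q : Set X} (h : Blk θ Q) {x : X} (hx : x ∈ Q) (y : X) :
    y ∈ Q ↔ θ x y := by
  obtain ⟨z, rfl⟩ := h
  exact ⟨fun hy => θ.trans' (θ.symm' hx) hy, fun hy => θ.trans' hx hy⟩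

lemma Blk.nonempty {θ : Setoid X} {Q : Set X} (h : Blk θ Q) : ∃ x, x ∈ Q := by
  obtain ⟨z, rfl⟩ := h
  exact ⟨z, θ.refl' z⟩

lemma blk_of {θ : Setoid X} {Q : Set X} {x : X} (h : ∀ y, y ∈ Q ↔ θ x y) : Blk θ Q :=
  ⟨x, Set.ext h⟩

lemma Blk.sat {θ : Setoid X} {Q : Set X} (h : Blk θ Q) : Sat θ Q := by
  intro x y hxy
  obtain ⟨z, rfl⟩ := h
  exact ⟨fun hy => θ.trans' hy hxy, fun hy => θ.trans' hy (θ.symm' hxy)⟩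

lemma Sat.mono {π θ : Setoid X} {Q : Set X} (h : Sat θ Q) (hle : π ≤ θ) : Sat π Q :=
  fun x y hxy => h x y (hle hxy)

lemma Sat.union {θ : Setoid X} {Q R : Set X} (h : Sat θ Q) (h' : Sat θ R) : Sat θ (Q ∪ R) :=
  fun x y hxy => by simp only [Set.mem_union, h x y hxy, h' x y hxy]

lemma Blk.eq_of_mem {θ : Setoid X} {Q R : Set X} (h : Blk θ Q) (h' : Blk θ R) {x : X}
    (hx : x ∈ Q) (hx' : x ∈ R) : Q = R := by
  ext y; rw [h.mem hx, h'.mem hx']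

lemma Blk.ncard {θ : Setoid X} {Q : Set X} (h : Blk θ Q) (h4 : IsNRel 4 θ) : Q.ncard = 4 := by
  obtain ⟨z, rfl⟩ := h
  exact (nrel_iff 4 θ).1 h4 z

/-- Shape of a block of a 4-relation above a 2-relation. -/
lemma blk_shape {π θ : Setoid X} (h2 : IsNRel 2 π) (h4 : IsNRel 4 θ) (hle : π ≤ θ) {Q : Set X}
    (hQ : Blk θ Q) {x : X} (hx : x ∈ Q) {p : X → X} (hpf : ∀ x, p x ≠ x) (hpp : ∀ x, p (p x) = x)
    (hp : ∀ x y, π x y ↔ y = x ∨ y = p x) :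
    ∃ y, y ≠ x ∧ y ≠ p x ∧ ∀ z, z ∈ Q ↔ z = x ∨ z = p x ∨ z = y ∨ z = p y := by
  have hc := hQ.ncard h4
  have : ∃ y ∈ Q, y ∉ ({x, p x} : Set X) := by
    by_contra hcon
    push Not at hcon
    have h1 := Set.ncard_le_ncard (s := Q) (t := {x, p x}) hcon (Set.toFinite _)
    have h2 := Set.ncard_pair (hpf x).symm
    omega
  obtain ⟨y, hy, hyn⟩ := this
  simp only [Set.mem_insert_iff, Set.mem_singleton_iff, not_or] at hyn
  refine ⟨y, hyn.1, hyn.2, fun z => ?_⟩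
  rw [hQ.mem hx]
  have hxy := (hQ.mem hx y).1 hy
  refine four_cls h4 (hpf x).symm (Ne.symm hyn.1) ?_ (Ne.symm hyn.2) ?_ (hpf y).symm
    (hle ((hp _ _).2 (Or.inr rfl))) hxy (θ.trans' hxy (hle ((hp _ _).2 (Or.inr rfl)))) z
  · intro h; exact hyn.2 (by rw [h, hpp])
  · intro h; exact hyn.1 (by rw [← hpp y, ← h, hpp])

/-! ### Gluing -/

/-- Glue `r` on `Z` and `s` on the complement. -/
def glue (Z : Set X) (r : Setoid X) (s : Setoid ↥(Zᶜ)) : Setoid X where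
  r x y := (x ∈ Z ∧ y ∈ Z ∧ r x y) ∨ ∃ (hx : x ∈ Zᶜ) (hy : y ∈ Zᶜ), s ⟨x, hx⟩ ⟨y, hy⟩
  iseqv := by
    refine ⟨fun x => ?_, ?_, ?_⟩
    · by_cases hx : x ∈ Z
      · exact Or.inl ⟨hx, hx, r.refl' x⟩
      · exact Or.inr ⟨hx, hx, s.refl' _⟩
    · rintro x y (⟨h1, h2, h3⟩ | ⟨h1, h2, h3⟩)
      · exact Or.inl ⟨h2, h1, r.symm' h3⟩
      · exact Or.inr ⟨h2, h1, s.symm' h3⟩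
    · rintro x y z (⟨h1, h2, h3⟩ | ⟨h1, h2, h3⟩) (⟨h4, h5, h6⟩ | ⟨h4, h5, h6⟩)
      · exact Or.inl ⟨h1, h5, r.trans' h3 h6⟩
      · exact absurd h2 h4
      · exact absurd h4 h2
      · exact Or.inr ⟨h1, h5, s.trans' h3 h6⟩

/-- Restriction to the complement. -/
def res (Z : Set X) (θ : Setoid X) : Setoid ↥(Zᶜ) := θ.comap Subtype.val

lemma glue_in {Z : Set X} {r : Setoid X} {s : Setoid ↥(Zᶜ)} {x : X} (hx : x ∈ Z) (y : X) :
    glue Z r s x y ↔ y ∈ Z ∧ r x y := by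
  constructor
  · rintro (⟨h1, h2, h3⟩ | ⟨h1, h2, h3⟩)
    · exact ⟨h2, h3⟩
    · exact absurd hx h1
  · rintro ⟨h1, h2⟩
    exact Or.inl ⟨hx, h1, h2⟩

lemma glue_out {Z : Set X} {r : Setoid X} {s : Setoid ↥(Zᶜ)} {x : X} (hx : x ∈ Zᶜ) (y : X) :
    glue Z r s x y ↔ ∃ hy : y ∈ Zᶜ, s ⟨x, hx⟩ ⟨y, hy⟩ := by
  constructor
  · rintro (⟨h1, h2, h3⟩ | ⟨h1, h2, h3⟩)
    · exact absurd h1 hx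
    · exact ⟨h2, h3⟩
  · rintro ⟨h1, h2⟩
    exact Or.inr ⟨hx, h1, h2⟩

lemma glue_nrel {n : ℕ} {Z : Set X} {r : Setoid X} {s : Setoid ↥(Zᶜ)}
    (hr : ∀ x ∈ Z, {y | y ∈ Z ∧ r x y}.ncard = n) (hs : IsNRel n s) : IsNRel n (glue Z r s) := by
  rw [nrel_iff]
  intro x
  by_cases hx : x ∈ Z
  · rw [← hr x hx]; congr 1; ext y; exact glue_in hx y
  · rw [← (nrel_iff n s).1 hs ⟨x, hx⟩, ← Set.ncard_image_of_injective _ Subtype.val_injective]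
    congr 1; ext y
    simp only [Set.mem_setOf_eq, Set.mem_image, Subtype.exists, exists_and_right, exists_eq_right]
    exact glue_out hx y

lemma res_nrel {n : ℕ} {Z : Set X} {θ : Setoid X} (hZ : Sat θ Z) (h : IsNRel n θ) :
    IsNRel n (res Z θ) := by
  rw [nrel_iff]
  rintro ⟨x, hx⟩
  rw [← (nrel_iff n θ).1 h x, ← Set.ncard_image_of_injective _ Subtype.val_injective]
  congr 1; ext y
  simp only [Set.mem_setOf_eq, Set.mem_image, Subtype.exists, exists_and_right, exists_eq_right]
  constructor
  · rintro ⟨hy, h⟩; exact h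
  · intro h
    exact ⟨fun hy => hx ((hZ x y h).2 hy), h⟩

lemma sat_ncard {n : ℕ} {Z : Set X} {θ : Setoid X} (hZ : Sat θ Z) (h : IsNRel n θ) :
    ∀ x ∈ Z, {y | y ∈ Z ∧ θ x y}.ncard = n := by
  intro x hx
  rw [← (nrel_iff n θ).1 h x]
  congr 1; ext y
  exact ⟨fun h => h.2, fun h => ⟨(hZ x y h).1 hx, h⟩⟩

lemma glue_res_out {Z : Set X} {r θ : Setoid X} (hZ : Sat θ Z) {x : X} (hx : x ∉ Z) (y : X) :
    glue Z r (res Z θ) x y ↔ θ x y := by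
  rw [glue_out (show x ∈ Zᶜ from hx)]
  exact ⟨fun ⟨_, h⟩ => h, fun h => ⟨fun hy => hx ((hZ x y h).2 hy), h⟩⟩

lemma glue_sat_in {Z : Set X} {r : Setoid X} {s : Setoid ↥(Zᶜ)} (hZ : Sat r Z) {x : X} (hx : x ∈ Z)
    (y : X) : glue Z r s x y ↔ r x y := by
  rw [glue_in hx]
  exact ⟨fun h => h.2, fun h => ⟨(hZ x y h).1 hx, h⟩⟩

lemma glue_le {Z : Set X} {r : Setoid X} {s : Setoid ↥(Zᶜ)} {θ : Setoid X}
    (h1 : ∀ x ∈ Z, ∀ y ∈ Z, r x y → θ x y) (h2 : ∀ x y, s x y → θ x.1 y.1) :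
    glue Z r s ≤ θ := by
  rintro x y (⟨h3, h4, h5⟩ | ⟨h3, h4, h5⟩)
  · exact h1 _ h3 _ h4 h5
  · exact h2 _ _ h5

lemma le_glue {Z : Set X} {r : Setoid X} {s : Setoid ↥(Zᶜ)} {π : Setoid X} (hZ : Sat π Z)
    (h1 : ∀ x ∈ Z, ∀ y ∈ Z, π x y → r x y) (h2 : ∀ x y : ↥(Zᶜ), π x.1 y.1 → s x y) :
    π ≤ glue Z r s := by
  intro x y hxy
  by_cases hx : x ∈ Z
  · exact Or.inl ⟨hx, (hZ x y hxy).1 hx, h1 _ hx _ ((hZ x y hxy).1 hx) hxy⟩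
  · have hy : y ∈ Zᶜ := fun hy => hx ((hZ x y hxy).2 hy)
    exact Or.inr ⟨hx, hy, h2 _ _ hxy⟩

/-- Two-valued relation : in `N` or not in `N`. -/
def spl (N : Set X) : Setoid X where
  r x y := x ∈ N ↔ y ∈ N
  iseqv := ⟨fun _ => Iff.rfl, fun h => h.symm, fun h h' => h.trans h'⟩

lemma spl_ncard {Z N : Set X} {n : ℕ} (hN : (Z ∩ N).ncard = n) (hN' : (Z \ N).ncard = n) :
    ∀ x ∈ Z, {y | y ∈ Z ∧ spl N x y}.ncard = n := by
  intro x hx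
  by_cases h : x ∈ N
  · rw [← hN]; congr 1; ext y
    exact ⟨fun hh => ⟨hh.1, hh.2.1 h⟩, fun hh => ⟨hh.1, iff_of_true h hh.2⟩⟩
  · rw [← hN']; congr 1; ext y
    exact ⟨fun hh => ⟨hh.1, fun h' => h (hh.2.2 h')⟩, fun hh => ⟨hh.1, iff_of_false h hh.2⟩⟩

/-! ### Swaps and regrouping -/

lemma swap_exists {π θ : Setoid X} (h2 : IsNRel 2 π) (h4 : IsNRel 4 θ) (hle : π ≤ θ) {Q : Set X}
    (hQ : Blk θ Q) : ∃ ρ : Setoid X, IsNRel 2 ρ ∧ ρ ≠ π ∧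
      ∀ θ', IsNRel 4 θ' → π ≤ θ' → (ρ ≤ θ' ↔ Blk θ' Q) := by
  obtain ⟨p, hpf, hpp, hp⟩ := two_fun h2
  obtain ⟨x, hx⟩ := hQ.nonempty
  obtain ⟨y, hyx, hyp, hz⟩ := blk_shape h2 h4 hle hQ hx hpf hpp hp
  have hxpy : x ≠ p y := fun h => hyp (by rw [h, hpp])
  have hpp' : p x ≠ p y := fun h => hyx (by rw [← hpp y, ← h, hpp])
  have hyQ : y ∈ Q := (hz y).2 (by tauto)
  have hpxQ : p x ∈ Q := (hz _).2 (by tauto)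
  have hpyQ : p y ∈ Q := (hz _).2 (by tauto)
  have hsat : Sat π Q := hQ.sat.mono hle
  have hρxy : (glue Q (spl {x, y}) (res Q π)) x y := (glue_in hx y).2 ⟨hyQ, by
    show x ∈ ({x, y} : Set X) ↔ y ∈ ({x, y} : Set X)
    simp⟩
  refine ⟨glue Q (spl {x, y}) (res Q π), glue_nrel (spl_ncard ?_ ?_) (res_nrel hsat h2), ?_, ?_⟩
  · have : Q ∩ {x, y} = {x, y} := by
      apply Set.inter_eq_right.2
      rintro z (rfl | rfl) <;> assumption
    rw [this, Set.ncard_pair hyx.symm]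
  · have : Q \ {x, y} = {p x, p y} := by
      ext z
      simp only [Set.mem_diff, hz, Set.mem_insert_iff, Set.mem_singleton_iff]
      constructor
      · tauto
      · rintro (rfl | rfl)
        · exact ⟨by tauto, by simp [hpf, hyp.symm]⟩
        · exact ⟨by tauto, by simp [hpf, hxpy.symm]⟩
    rw [this, Set.ncard_pair hpp']
  · intro h
    rw [h, hp] at hρxy
    tauto
  · intro θ' h4' hle'
    constructor
    · intro h
      have hxy := h hρxy
      refine blk_of (x := x) fun z => ?_
      rw [hz]
      exact (four_cls h4' (hpf x).symm (Ne.symm hyx) hxpy (Ne.symm hyp) hpp' (hpf y).symm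
        (hle' ((hp _ _).2 (Or.inr rfl))) hxy
        (θ'.trans' hxy (hle' ((hp _ _).2 (Or.inr rfl)))) z).symm
    · intro h
      apply glue_le
      · intro u hu v hv _
        exact (h.mem hu v).1 hv
      · intro u v huv
        exact hle' huv

/-- A block on which two 2-relations disagree is forced. -/
lemma forced {π ρ θ θ' : Setoid X} (h2 : IsNRel 2 π) (h2' : IsNRel 2 ρ) (h4 : IsNRel 4 θ)
    (h4' : IsNRel 4 θ') (h11 : π ≤ θ) (h12 : ρ ≤ θ) (h21 : π ≤ θ') (h22 : ρ ≤ θ') {x y : X}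
    (hxy : ¬ (π x y ↔ ρ x y)) : ∀ z, θ x z ↔ θ' x z := by
  obtain ⟨p, hpf, hpp, hp⟩ := two_fun h2
  obtain ⟨q, hqf, hqq, hq⟩ := two_fun h2'
  have hne : p x ≠ q x := by
    intro h
    rw [hp, hq, h] at hxy
    exact hxy Iff.rfl
  have key : ∀ θ : Setoid X, IsNRel 4 θ → π ≤ θ → ρ ≤ θ → ∀ z, θ x z ↔ z = x ∨ z = p x ∨ z = q x ∨
      z = p (q x) := by
    intro θ h4 h1 h2 z
    have ha : θ x (q x) := h2 ((hq _ _).2 (Or.inr rfl))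
    refine four_cls h4 (hpf x).symm (hqf x).symm ?_ hne ?_ (hpf _).symm
      (h1 ((hp _ _).2 (Or.inr rfl))) ha (θ.trans' ha (h1 ((hp _ _).2 (Or.inr rfl)))) z
    · intro h; exact hne (by rw [h, hpp, ← h])
    · intro h; exact hqf x (by rw [← hpp (q x), ← h, hpp])
  intro z
  rw [key θ h4 h11 h12, key θ' h4' h21 h22]

/-- Regrouping two blocks on which `π` and `ρ` agree. -/
lemma regroup {π ρ θ : Setoid X} (h2 : IsNRel 2 π) (h2' : IsNRel 2 ρ) (h4 : IsNRel 4 θ)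
    (h1 : π ≤ θ) (h1' : ρ ≤ θ) {R R' : Set X} (hR : Blk θ R) (hR' : Blk θ R') (hne : R ≠ R')
    (ha : ∀ x ∈ R, ∀ y, π x y ↔ ρ x y) (ha' : ∀ x ∈ R', ∀ y, π x y ↔ ρ x y) :
    ∃ θ', IsNRel 4 θ' ∧ π ≤ θ' ∧ ρ ≤ θ' ∧ ¬ Blk θ' R ∧
      ∀ Q, Blk θ Q → Q ≠ R → Q ≠ R' → Blk θ' Q := by
  obtain ⟨p, hpf, hpp, hp⟩ := two_fun h2
  obtain ⟨x, hx⟩ := hR.nonempty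
  obtain ⟨y, hy⟩ := hR'.nonempty
  obtain ⟨u, hux, hupx, hu⟩ := blk_shape h2 h4 h1 hR hx hpf hpp hp
  obtain ⟨v, hvy, hvpy, hv⟩ := blk_shape h2 h4 h1 hR' hy hpf hpp hp
  have hinj : ∀ {a b : X}, p a = p b → a = b := fun {a b} h => by rw [← hpp a, h, hpp]
  have hswp : ∀ {a b : X}, a = p b → b = p a := fun {a b} h => by rw [h, hpp]
  have hdis : ∀ a, a ∈ R → a ∈ R' → False := fun a h h' => hne (hR.eq_of_mem hR' h h')
  set Z := R ∪ R' with hZ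
  set N : Set X := {x, p x, y, p y} with hN
  have hNsat : Sat π N := by
    intro a b hab
    rcases (hp _ _).1 hab with rfl | rfl
    · exact Iff.rfl
    · simp only [hN, Set.mem_insert_iff, Set.mem_singleton_iff]
      constructor
      · rintro (rfl | rfl | rfl | rfl) <;> simp [hpp]
      · rintro (h | h | h | h)
        · exact Or.inr (Or.inl (hswp h.symm))
        · exact Or.inl (hinj h)
        · exact Or.inr (Or.inr (Or.inr (hswp h.symm)))
        · exact Or.inr (Or.inr (Or.inl (hinj h)))
  have hZs : Sat θ Z := hR.sat.union hR'.sat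
  have hRx : ∀ z, z = x ∨ z = p x ∨ z = u ∨ z = p u → z ∈ R := fun z h => (hu z).2 h
  have hRy : ∀ z, z = y ∨ z = p y ∨ z = v ∨ z = p v → z ∈ R' := fun z h => (hv z).2 h
  have hd : ∀ a b, (a = x ∨ a = p x ∨ a = u ∨ a = p u) → (b = y ∨ b = p y ∨ b = v ∨ b = p v) →
      a ≠ b := fun a b h h' hab => hdis a (hRx a h) (hab ▸ hRy b h')
  have hxpu : x ≠ p u := fun h => hupx (hswp h)
  have hypv : y ≠ p v := fun h => hvpy (hswp h)
  have hpxu : p x ≠ p u := fun h => hux (hinj h).symm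
  have hpyv : p y ≠ p v := fun h => hvy (hinj h).symm
  refine ⟨glue Z (spl N) (res Z θ), glue_nrel (spl_ncard ?_ ?_) (res_nrel hZs h4), ?_, ?_, ?_, ?_⟩
  · have : Z ∩ N = N := by
      apply Set.inter_eq_right.2
      rintro z (rfl | rfl | rfl | rfl)
      · exact Or.inl (hRx _ (by tauto))
      · exact Or.inl (hRx _ (by tauto))
      · exact Or.inr (hRy _ (by tauto))
      · exact Or.inr (hRy _ (by tauto))
    rw [this, hN]
    exact ncard_four (hpf x).symm (hd _ _ (by tauto) (by tauto)) (hd _ _ (by tauto) (by tauto))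
      (hd _ _ (by tauto) (by tauto)) (hd _ _ (by tauto) (by tauto)) (hpf y).symm
  · have : Z \ N = {u, p u, v, p v} := by
      ext z
      simp only [hN, hZ, Set.mem_diff, Set.mem_union, hu, hv, Set.mem_insert_iff,
        Set.mem_singleton_iff]
      constructor
      · tauto
      · intro h
        refine ⟨by tauto, ?_⟩
        rcases h with rfl | rfl | rfl | rfl
        · simp only [not_or]
          exact ⟨hux, hupx, hd _ _ (by tauto) (by tauto), hd _ _ (by tauto) (by tauto)⟩
        · simp only [not_or]
          exact ⟨hxpu.symm, hpxu.symm, hd _ _ (by tauto) (by tauto), hd _ _ (by tauto) (by tauto)⟩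
        · simp only [not_or]
          exact ⟨(hd _ _ (by tauto) (by tauto)).symm, (hd _ _ (by tauto) (by tauto)).symm, hvy, hvpy⟩
        · simp only [not_or]
          exact ⟨(hd _ _ (by tauto) (by tauto)).symm, (hd _ _ (by tauto) (by tauto)).symm,
            hypv.symm, hpyv.symm⟩
    rw [this]
    exact ncard_four (hpf u).symm (hd _ _ (by tauto) (by tauto)) (hd _ _ (by tauto) (by tauto))
      (hd _ _ (by tauto) (by tauto)) (hd _ _ (by tauto) (by tauto)) (hpf v).symm
  · exact le_glue (hZs.mono h1) (fun a _ b _ hab => hNsat a b hab) (fun a b hab => h1 hab)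
  · refine le_glue (hZs.mono h1') (fun a haZ b _ hab => hNsat a b ?_) (fun a b hab => h1' hab)
    rcases haZ with h | h
    · exact (ha a h b).2 hab
    · exact (ha' a h b).2 hab
  · intro hB
    have h3 : glue Z (spl N) (res Z θ) x u := (hB.mem hx u).1 (hRx _ (by tauto))
    have h4 := ((glue_in (show x ∈ Z from Or.inl hx) u).1 h3).2
    have h5 : u ∈ N := h4.1 (by simp [hN])
    simp only [hN, Set.mem_insert_iff, Set.mem_singleton_iff] at h5
    have := hd u y (by tauto) (by tauto)
    have := hd u (p y) (by tauto) (by tauto)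
    tauto
  · intro Q hQ hQR hQR'
    obtain ⟨z, hz⟩ := hQ.nonempty
    refine blk_of (x := z) fun w => ?_
    rw [glue_res_out hZs, hQ.mem hz]
    rintro (h | h)
    · exact hQR (hQ.eq_of_mem hR hz h)
    · exact hQR' (hQ.eq_of_mem hR' hz h)

end basics
end EqS
namespace EqS

/-- The type of `n`-relations. -/
abbrev NR (n : ℕ) (X : Type*) := {θ : Setoid X // IsNRel n θ}

section rel
variable {X : Type*}

/-- Compatibility of bijections on 2-relations and 4-relations. -/
def Compat (e2 : NR 2 X ≃ NR 2 X) (e4 : NR 4 X ≃ NR 4 X) : Prop :=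
  ∀ π θ, π.1 ≤ θ.1 ↔ (e2 π).1 ≤ (e4 θ).1

lemma Compat.symm {e2 : NR 2 X ≃ NR 2 X} {e4 : NR 4 X ≃ NR 4 X} (h : Compat e2 e4) :
    Compat e2.symm e4.symm := fun π θ => by
  rw [h (e2.symm π) (e4.symm θ)]; simp

/-- The 4-set `Q` seen from `π` corresponds to the 4-set `P`. -/
def Rel (e4 : NR 4 X ≃ NR 4 X) (π : NR 2 X) (Q P : Set X) : Prop :=
  (∃ θ : NR 4 X, π.1 ≤ θ.1 ∧ Blk θ.1 Q ∧ Blk (e4 θ).1 P) ∧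
    ∀ θ : NR 4 X, π.1 ≤ θ.1 → (Blk θ.1 Q ↔ Blk (e4 θ).1 P)

lemma exists_blk_not [Infinite X] (θ : NR 4 X) (F : Set X) (hF : F.Finite) :
    ∃ R, Blk θ.1 R ∧ Disjoint R F := by
  have hfin : ∀ x, {y | θ.1 x y}.Finite := fun x =>
    Set.finite_of_ncard_ne_zero (by rw [(nrel_iff 4 θ.1).1 θ.2 x]; omega)
  have : (⋃ x ∈ F, {y | θ.1 x y}).Finite := hF.biUnion fun x _ => hfin x
  obtain ⟨z, hz⟩ := this.exists_notMem
  simp only [Set.mem_iUnion, not_exists] at hz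
  refine ⟨{y | θ.1 z y}, ⟨z, rfl⟩, Set.disjoint_left.2 fun y hy hyF => hz y hyF (θ.1.symm' hy)⟩

lemma Blk.finite {θ : NR 4 X} {Q : Set X} (h : Blk θ.1 Q) : Q.Finite :=
  Set.finite_of_ncard_ne_zero (by rw [h.ncard θ.2]; omega)

lemma Blk.ne_of_disj {θ : Setoid X} {Q R F : Set X} (h : Blk θ Q) (hd : Disjoint Q F) (hR : R ⊆ F) :
    Q ≠ R := by
  rintro rfl
  obtain ⟨x, hx⟩ := h.nonempty
  exact Set.disjoint_left.1 hd hx (hR hx)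

/-- A block of all 4-relations above `π` containing `Q` is `Q`. -/
lemma only_blk [Infinite X] {π : NR 2 X} {Q P : Set X} {θ : NR 4 X} (hle : π.1 ≤ θ.1)
    (hQ : Blk θ.1 Q) (h : ∀ θ : NR 4 X, π.1 ≤ θ.1 → Blk θ.1 Q → Blk θ.1 P) : P = Q := by
  by_contra hne
  have hP := h θ hle hQ
  obtain ⟨R, hR, hRd⟩ := exists_blk_not θ (Q ∪ P) (hQ.finite.union hP.finite)
  have hRQ : R ≠ Q := hR.ne_of_disj hRd Set.subset_union_left
  have hRP : R ≠ P := hR.ne_of_disj hRd Set.subset_union_right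
  obtain ⟨θ', h4, hle', _, hn, hall⟩ := regroup π.2 π.2 θ.2 hle hle hP hR hRP.symm
    (fun _ _ _ => Iff.rfl) (fun _ _ _ => Iff.rfl)
  exact hn (h ⟨θ', h4⟩ hle' (hall Q hQ (Ne.symm hne) hRQ.symm))

variable {e2 : NR 2 X ≃ NR 2 X} {e4 : NR 4 X ≃ NR 4 X}

lemma Rel.symm (hc : Compat e2 e4) {π : NR 2 X} {Q P : Set X} (h : Rel e4 π Q P) :
    Rel e4.symm (e2 π) P Q := by
  obtain ⟨⟨θ, h1, h2, h3⟩, h4⟩ := h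
  refine ⟨⟨e4 θ, (hc π θ).1 h1, h3, by simpa using h2⟩, fun θ' hle => ?_⟩
  have := h4 (e4.symm θ') ((hc _ _).2 (by simpa using hle))
  simpa using this.symm

lemma Rel.blk {π : NR 2 X} {Q P : Set X} (h : Rel e4 π Q P) {θ : NR 4 X} (hle : π.1 ≤ θ.1)
    (hQ : Blk θ.1 Q) : Blk (e4 θ).1 P := (h.2 θ hle).1 hQ

lemma Rel.inj [Infinite X] {π : NR 2 X} {Q Q' P : Set X} (h : Rel e4 π Q P) (h' : Rel e4 π Q' P) :
    Q' = Q := by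
  obtain ⟨⟨θ, h1, h2, h3⟩, h4⟩ := h
  exact only_blk h1 h2 fun θ' hle hQ => (h'.2 θ' hle).2 ((h4 θ' hle).1 hQ)

lemma rel_exists [Infinite X] (hc : Compat e2 e4) {π : NR 2 X} {θ : NR 4 X} (hle : π.1 ≤ θ.1)
    {Q : Set X} (hQ : Blk θ.1 Q) : ∃ P, Rel e4 π Q P := by
  have diff : ∀ {a b : NR 2 X}, a ≠ b → ∃ x y, ¬ (a.1 x y ↔ b.1 x y) := by
    intro a b hab
    by_contra hcon
    push Not at hcon
    exact hab (Subtype.ext (Setoid.ext hcon))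
  obtain ⟨ρ, hρ2, hρne, hρ⟩ := swap_exists π.2 θ.2 hle hQ
  have hρθ := (hρ θ.1 θ.2 hle).2 hQ
  obtain ⟨x, y, hxy⟩ := diff (a := e2 π) (b := e2 ⟨ρ, hρ2⟩) (fun h => hρne (by
    have := e2.injective h
    rw [this]))
  set P := {z | (e4 θ).1 x z} with hP
  have hPb : Blk (e4 θ).1 P := ⟨x, rfl⟩
  have hfwd : ∀ θ' : NR 4 X, π.1 ≤ θ'.1 → Blk θ'.1 Q → Blk (e4 θ').1 P := by
    intro θ' hle' hQ'
    have h1 : ρ ≤ θ'.1 := (hρ θ'.1 θ'.2 hle').2 hQ'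
    refine ⟨x, Set.ext fun z => ?_⟩
    exact forced (e2 π).2 (e2 ⟨ρ, hρ2⟩).2 (e4 θ).2 (e4 θ').2 ((hc _ _).1 hle)
      ((hc ⟨ρ, hρ2⟩ _).1 hρθ) ((hc _ _).1 hle') ((hc ⟨ρ, hρ2⟩ _).1 h1) hxy z
  refine ⟨P, ⟨θ, hle, hQ, hPb⟩, fun θ' hle' => ⟨hfwd θ' hle', fun hP' => ?_⟩⟩
  obtain ⟨ρ', hρ2', hρne', hρ'⟩ := swap_exists (e2 π).2 (e4 θ).2 ((hc _ _).1 hle) hPb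
  set τ : NR 2 X := e2.symm ⟨ρ', hρ2'⟩ with hτ
  have hτ' : ∀ θ' : NR 4 X, π.1 ≤ θ'.1 → (τ.1 ≤ θ'.1 ↔ Blk (e4 θ').1 P) := by
    intro θ' h
    rw [hc τ θ', ← hρ' (e4 θ').1 (e4 θ').2 ((hc _ _).1 h), hτ]
    simp
  have hτne : π ≠ τ := by
    intro h
    apply hρne'
    rw [h, hτ]; simp
  obtain ⟨u, v, huv⟩ := diff hτne
  have hτθ := (hτ' θ hle).2 hPb
  have hforce : ∀ θ' : NR 4 X, π.1 ≤ θ'.1 → τ.1 ≤ θ'.1 → Blk θ'.1 {z | θ.1 u z} := by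
    intro θ' h1 h2
    exact ⟨u, Set.ext fun z => forced π.2 τ.2 θ.2 θ'.2 hle hτθ h1 h2 huv z⟩
  have heq : {z | θ.1 u z} = Q := only_blk hle hQ fun θ'' h1 h2 =>
    hforce θ'' h1 ((hτ' θ'' h1).2 (hfwd θ'' h1 h2))
  rw [← heq]
  exact hforce θ' hle' ((hτ' θ' hle').2 hP')

/-- Independence when `π` and `ρ` agree on three blocks. -/
lemma rel_agree [Infinite X] (hc : Compat e2 e4) {π ρ : NR 2 X} {θ : NR 4 X} (hle : π.1 ≤ θ.1)
    (hle' : ρ.1 ≤ θ.1) {Q Q2 Q3 : Set X} (hQ : Blk θ.1 Q) (hQ2 : Blk θ.1 Q2) (hQ3 : Blk θ.1 Q3)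
    (h12 : Q ≠ Q2) (h13 : Q ≠ Q3) (h23 : Q2 ≠ Q3) (ha : ∀ x ∈ Q, ∀ y, π.1 x y ↔ ρ.1 x y)
    (ha2 : ∀ x ∈ Q2, ∀ y, π.1 x y ↔ ρ.1 x y) (ha3 : ∀ x ∈ Q3, ∀ y, π.1 x y ↔ ρ.1 x y)
    {P P' : Set X} (hP : Rel e4 π Q P) (hP' : Rel e4 ρ Q P') : P = P' := by
  have agree : ∀ {Q R P : Set X}, Blk θ.1 Q → Blk θ.1 R → Q ≠ R →
      (∀ x ∈ Q, ∀ y, π.1 x y ↔ ρ.1 x y) → (∀ x ∈ R, ∀ y, π.1 x y ↔ ρ.1 x y) → Rel e4 π Q P →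
      ∀ x ∈ P, ∀ y, (e2 π).1 x y ↔ (e2 ρ).1 x y := by
    intro Q R P hQ hR hne ha1 ha2 hP x hx y
    by_contra hcon
    obtain ⟨θ', h4, hl, hl', hn, -⟩ := regroup π.2 ρ.2 θ.2 hle hle' hQ hR hne ha1 ha2
    have hb := hP.blk hle hQ
    apply hn
    refine (hP.2 ⟨θ', h4⟩ hl).2 ⟨x, Set.ext fun z => ?_⟩
    rw [hb.mem hx]
    exact forced (e2 π).2 (e2 ρ).2 (e4 θ).2 (e4 ⟨θ', h4⟩).2 ((hc _ _).1 hle) ((hc _ _).1 hle')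
      ((hc π ⟨θ', h4⟩).1 hl) ((hc ρ ⟨θ', h4⟩).1 hl') hcon z
  by_contra hne
  have main : ∀ {R S : Set X}, Blk θ.1 R → Q ≠ R → (∀ x ∈ R, ∀ y, π.1 x y ↔ ρ.1 x y) →
      Rel e4 π R S → S ≠ P' → False := by
    intro R S hR hQR haR hS hSP
    have hPS : P ≠ S := fun h => hQR (by subst h; exact hS.inj hP)
    obtain ⟨ψ, h4, hl, hl', hn, hall⟩ := regroup (e2 π).2 (e2 ρ).2 (e4 θ).2 ((hc _ _).1 hle)
      ((hc _ _).1 hle') (hP.blk hle hQ) (hS.blk hle hR) hPS (agree hQ hR hQR ha haR hP)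
      (agree hR hQ hQR.symm haR ha hS)
    have hP'b := hall P' (hP'.blk hle' hQ) (Ne.symm hne) hSP.symm
    set θ' := e4.symm ⟨ψ, h4⟩ with hθ'
    have he : e4 θ' = ⟨ψ, h4⟩ := by simp [hθ']
    have k1 : π.1 ≤ θ'.1 := (hc _ _).2 (by rw [he]; exact hl)
    have k2 : ρ.1 ≤ θ'.1 := (hc _ _).2 (by rw [he]; exact hl')
    have k3 := (hP'.2 θ' k2).2 (by rw [he]; exact hP'b)
    have k4 := (hP.2 θ' k1).1 k3
    rw [he] at k4
    exact hn k4
  obtain ⟨P2, hP2⟩ := rel_exists hc hle hQ2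
  obtain ⟨P3, hP3⟩ := rel_exists hc hle hQ3
  by_cases h : P2 = P'
  · refine main hQ3 h13 ha3 hP3 fun h' => h23 ?_
    subst h; subst h'
    exact hP3.inj hP2
  · exact main hQ2 h12 ha2 hP2 h

/-- Independence when `π` and `ρ` differ only on `Q`. -/
lemma rel_swap [Infinite X] (hc : Compat e2 e4) {π ρ : NR 2 X} {θ : NR 4 X} (hle : π.1 ≤ θ.1)
    (hle' : ρ.1 ≤ θ.1) {Q : Set X} (hQ : Blk θ.1 Q) (ha : ∀ x, x ∉ Q → ∀ y, π.1 x y ↔ ρ.1 x y)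
    {P P' : Set X} (hP : Rel e4 π Q P) (hP' : Rel e4 ρ Q P') : P = P' := by
  symm
  refine only_blk (π := e2 π) (θ := e4 θ) ((hc _ _).1 hle) (hP.blk hle hQ) fun ψ h1 h2 => ?_
  obtain ⟨θ', rfl⟩ := e4.surjective ψ
  have h1' := (hc _ _).2 h1
  have h2' := (hP.2 θ' h1').2 h2
  refine hP'.blk ?_ h2'
  intro x y hxy
  by_cases hx : x ∈ Q
  · exact (h2'.mem hx y).1 ((hQ.mem hx y).2 (hle' hxy))
  · exact h1' ((ha x hx y).2 hxy)

/-- Mixing. -/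
lemma mix_spec {π ρ : NR 2 X} {θ : NR 4 X} (hle : π.1 ≤ θ.1) (hle' : ρ.1 ≤ θ.1) {A : Set X}
    (hA : Sat θ.1 A) : ∃ d : NR 2 X, d.1 ≤ θ.1 ∧ (∀ x ∈ A, ∀ y, d.1 x y ↔ π.1 x y) ∧
      ∀ x, x ∉ A → ∀ y, d.1 x y ↔ ρ.1 x y := by
  refine ⟨⟨glue A π.1 (res A ρ.1), glue_nrel (sat_ncard (hA.mono hle) π.2)
    (res_nrel (hA.mono hle') ρ.2)⟩, ?_, ?_, ?_⟩
  · exact glue_le (fun x _ y _ h => hle h) (fun x y h => hle' h)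
  · exact fun x hx y => glue_sat_in (hA.mono hle) hx y
  · exact fun x hx y => glue_res_out (hA.mono hle') hx y

lemma rel_indep [Infinite X] (hc : Compat e2 e4) {π ρ : NR 2 X} {θ : NR 4 X} (hle : π.1 ≤ θ.1)
    (hle' : ρ.1 ≤ θ.1) {Q : Set X} (hQ : Blk θ.1 Q)
    {P P' : Set X} (hP : Rel e4 π Q P) (hP' : Rel e4 ρ Q P') : P = P' := by
  obtain ⟨Q2, b2, d2⟩ := exists_blk_not θ Q hQ.finite
  obtain ⟨Q3, b3, d3⟩ := exists_blk_not θ (Q ∪ Q2) (hQ.finite.union b2.finite)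
  obtain ⟨Q4, b4, d4⟩ := exists_blk_not θ (Q ∪ (Q2 ∪ Q3))
    (hQ.finite.union (b2.finite.union b3.finite))
  obtain ⟨Q5, b5, d5⟩ := exists_blk_not θ (Q ∪ (Q2 ∪ Q3) ∪ Q4)
    ((hQ.finite.union (b2.finite.union b3.finite)).union b4.finite)
  have n12 : Q2 ≠ Q := b2.ne_of_disj d2 subset_rfl
  have n13 : Q3 ≠ Q := b3.ne_of_disj d3 Set.subset_union_left
  have n23 : Q3 ≠ Q2 := b3.ne_of_disj d3 Set.subset_union_right
  have n14 : Q4 ≠ Q := b4.ne_of_disj d4 Set.subset_union_left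
  have n15 : Q5 ≠ Q := b5.ne_of_disj d5 (Set.subset_union_left.trans Set.subset_union_left)
  have n45 : Q5 ≠ Q4 := b5.ne_of_disj d5 Set.subset_union_right
  rw [Set.disjoint_left] at d2 d3 d4 d5
  simp only [Set.mem_union, not_or] at d2 d3 d4 d5
  obtain ⟨d, hd, hd1, hd2⟩ := mix_spec hle hle' (A := Q ∪ (Q2 ∪ Q3))
    (hQ.sat.union (b2.sat.union b3.sat))
  obtain ⟨d', hd', hd1', hd2'⟩ := mix_spec hle hle' (A := Q2 ∪ Q3) (b2.sat.union b3.sat)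
  simp only [Set.mem_union, not_or] at hd1 hd2 hd1' hd2'
  obtain ⟨P1, hP1⟩ := rel_exists hc hd hQ
  obtain ⟨P2, hP2⟩ := rel_exists hc hd' hQ
  have e1 : P = P1 := rel_agree hc hle hd hQ b2 b3 n12.symm n13.symm n23.symm
    (fun x hx y => (hd1 x (by tauto) y).symm) (fun x hx y => (hd1 x (by tauto) y).symm)
    (fun x hx y => (hd1 x (by tauto) y).symm) hP hP1
  have e2 : P1 = P2 := rel_swap hc hd hd' hQ (fun x hx y => by
    by_cases h : x ∈ Q2 ∨ x ∈ Q3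
    · rw [hd1 x (by tauto), hd1' x h]
    · rw [hd2 x (by tauto), hd2' x (by tauto)]) hP1 hP2
  have e3 : P2 = P' := rel_agree hc hd' hle' hQ b4 b5 n14.symm n15.symm n45.symm
    (fun x hx y => hd2' x ⟨fun h => d2 h hx, fun h => (d3 h).1 hx⟩ y)
    (fun x hx y => hd2' x (d4 hx).2 y)
    (fun x hx y => hd2' x (d5 hx).1.2 y) hP2 hP'
  rw [e1, e2, e3]

end rel
end EqS
namespace EqS

section conn
variable {Y : Type*}

/-- The reflection: an involution without fixed points commuting with two given ones. -/
lemma reflection (a b : Equiv.Perm Y) (ha : ∀ x, a (a x) = x) (hb : ∀ x, b (b x) = x)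
    (haf : ∀ x, a x ≠ x) (hbf : ∀ x, b x ≠ x) : ∃ c : Y → Y, (∀ x, c (c x) = x) ∧
      (∀ x, c x ≠ x) ∧ (∀ x, c (a x) = a (c x)) ∧ ∀ x, c (b x) = b (c x) := by
  set t : Equiv.Perm Y := a * b with ht
  have ha1 : a * a = 1 := Equiv.ext ha
  have hb1 : b * b = 1 := Equiv.ext hb
  have hai : a⁻¹ = a := inv_eq_of_mul_eq_one_left ha1
  have hbi : b⁻¹ = b := inv_eq_of_mul_eq_one_left hb1
  have hconj : a * t * a⁻¹ = t⁻¹ := by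
    rw [ht, mul_inv_rev, hai, hbi, ← mul_assoc, ha1, one_mul]
  have hk : ∀ k : ℤ, a * t ^ k = t ^ (-k) * a := by
    intro k
    have : a * t ^ k * a⁻¹ = t ^ (-k) := by
      rw [← conj_zpow, hconj, inv_zpow, zpow_neg]
    rw [← this, inv_mul_cancel_right]
  have hkx : ∀ (k : ℤ) x, a ((t ^ k) x) = (t ^ (-k)) (a x) := fun k x => by
    have := congrArg (fun e : Equiv.Perm Y => e x) (hk k)
    simpa using this
  have hadd : ∀ (k l : ℤ) x, (t ^ k) ((t ^ l) x) = (t ^ (k + l)) x := fun k l x => by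
    rw [zpow_add]; rfl
  have hz : ∀ x, (t ^ (0 : ℤ)) x = x := fun x => by simp
  have hfix : ∀ (k : ℤ) x, (t ^ k) (a x) ≠ x := by
    intro k x h
    obtain ⟨m, hm | hm⟩ := Int.even_or_odd' k
    · apply haf ((t ^ (-m)) x)
      rw [hkx, neg_neg]
      have := congrArg (t ^ (-m)) h
      rw [hadd, hm] at this
      rw [← this]; congr 2; ring
    · have h1 := congrArg (t ^ (-m)) h
      rw [hadd, hm] at h1
      have h2 : (t ^ (m + 1)) (a x) = (t ^ (-m)) x := by
        rw [← h1]; congr 2; ring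
      have h3 : t (a ((t ^ (-m)) x)) = (t ^ (-m)) x := by
        rw [hkx, neg_neg, ← h2, ← hadd]
        have := hadd 1 m (a x)
        rw [zpow_one] at this
        rw [this, hadd]; congr 2; ring
      have h4 : a (b (a ((t ^ (-m)) x))) = (t ^ (-m)) x := h3
      apply hbf (a ((t ^ (-m)) x))
      rw [← ha (b _), h4]
  -- orbits
  let o : Setoid Y :=
    { r := fun x y => ∃ k : ℤ, y = (t ^ k) x ∨ y = (t ^ k) (a x)
      iseqv := by
        refine ⟨fun x => ⟨0, Or.inl (hz x).symm⟩, ?_, ?_⟩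
        · rintro x y ⟨k, rfl | rfl⟩
          · exact ⟨-k, Or.inl (by rw [hadd]; simp)⟩
          · exact ⟨k, Or.inr (by rw [hkx, ha, hadd]; simp)⟩
        · rintro x y z ⟨k, rfl | rfl⟩ ⟨l, rfl | rfl⟩
          · exact ⟨l + k, Or.inl (by rw [hadd])⟩
          · exact ⟨l + -k, Or.inr (by rw [hkx, hadd])⟩
          · exact ⟨l + k, Or.inr (by rw [hadd])⟩
          · exact ⟨l + -k, Or.inl (by rw [hkx, hadd, ha])⟩ }
  let rep : Y → Y := fun x => (Quotient.mk o x).out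
  have hrep : ∀ x, o (rep x) x := fun x => Quotient.exact (s := o) (Quotient.out_eq _)
  have hrepeq : ∀ x y, o x y → rep x = rep y := fun x y h =>
    congrArg Quotient.out (Quotient.sound (s := o) h)
  let R : Y → Y → Y → Prop := fun x0 x z =>
    (∃ k : ℤ, x = (t ^ k) x0 ∧ z = (t ^ k) (a x0)) ∨
      (∃ k : ℤ, x = (t ^ k) (a x0) ∧ z = (t ^ k) x0)
  have hRsymm : ∀ x0 x z, R x0 x z → R x0 z x := by
    rintro x0 x z (⟨k, h1, h2⟩ | ⟨k, h1, h2⟩)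
    · exact Or.inr ⟨k, h2, h1⟩
    · exact Or.inl ⟨k, h2, h1⟩
  have hmix : ∀ (k l : ℤ) x0, (t ^ k) x0 ≠ (t ^ l) (a x0) := by
    intro k l x0 h
    have := congrArg (t ^ (-k)) h
    rw [hadd, hadd, neg_add_cancel, hz] at this
    exact hfix _ _ this.symm
  have hst : ∀ (k l : ℤ) x0, (t ^ k) x0 = (t ^ l) x0 → (t ^ k) (a x0) = (t ^ l) (a x0) := by
    intro k l x0 h
    have h1 := congrArg (t ^ (-k-l)) h
    rw [hadd, hadd] at h1
    have h2 : (t ^ (-l)) x0 = (t ^ (-k)) x0 := by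
      rw [show -k - l + k = -l by ring, show -k - l + l = -k by ring] at h1; exact h1
    have h3 := congrArg a h2
    rw [hkx, hkx, neg_neg, neg_neg] at h3
    exact h3.symm
  have hRu : ∀ x0 x z w, R x0 x z → R x0 x w → z = w := by
    rintro x0 x z w (⟨k, h1, h2⟩ | ⟨k, h1, h2⟩) (⟨l, h3, h4⟩ | ⟨l, h3, h4⟩)
    · rw [h2, h4]; exact hst _ _ _ (h1.symm.trans h3)
    · exact absurd (h1.symm.trans h3) (hmix _ _ _)
    · exact absurd (h3.symm.trans h1) (hmix _ _ _)
    · rw [h2, h4]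
      have := hst k l (a x0) (h1.symm.trans h3)
      rwa [ha] at this
  have hRa : ∀ x0 x z, R x0 x z → R x0 (a x) (a z) := by
    rintro x0 x z (⟨k, rfl, rfl⟩ | ⟨k, rfl, rfl⟩)
    · exact Or.inr ⟨-k, by rw [hkx], by rw [hkx, ha]⟩
    · exact Or.inl ⟨-k, by rw [hkx, ha], by rw [hkx]⟩
  have htk : ∀ (k : ℤ) x, t ((t ^ k) x) = (t ^ (1 + k)) x := fun k x => by
    rw [← hadd, zpow_one]
  have hRt : ∀ x0 x z, R x0 x z → R x0 (t x) (t z) := by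
    rintro x0 x z (⟨k, rfl, rfl⟩ | ⟨k, rfl, rfl⟩)
    · exact Or.inl ⟨1 + k, by rw [htk], by rw [htk]⟩
    · exact Or.inr ⟨1 + k, by rw [htk], by rw [htk]⟩
  have hRb : ∀ x0 x z, R x0 x z → R x0 (b x) (b z) := by
    intro x0 x z h
    have := hRa _ _ _ (hRt _ _ _ h)
    have hat : ∀ x, a (t x) = b x := fun x => ha (b x)
    rwa [hat, hat] at this
  have hRo : ∀ x0 x z, R x0 x z → o x0 z := by
    rintro x0 x z (⟨k, h1, h2⟩ | ⟨k, h1, h2⟩)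
    · exact ⟨k, Or.inr h2⟩
    · exact ⟨k, Or.inl h2⟩
  have hRne : ∀ x0 x z, R x0 x z → z ≠ x := by
    rintro x0 x z (⟨k, rfl, rfl⟩ | ⟨k, rfl, rfl⟩)
    · exact (hmix _ _ _).symm
    · exact hmix _ _ _
  have hex : ∀ x, ∃ z, R (rep x) x z := by
    intro x
    obtain ⟨k, h | h⟩ := hrep x
    · exact ⟨_, Or.inl ⟨k, h, rfl⟩⟩
    · exact ⟨_, Or.inr ⟨k, h, rfl⟩⟩
  choose c hcR using hex
  have hcrep : ∀ x, rep (c x) = rep x := fun x => by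
    rw [← hrepeq _ _ (hRo _ _ _ (hcR x))]
    exact hrepeq _ _ (hrep x)
  have hrepa : ∀ x, rep (a x) = rep x := fun x =>
    (hrepeq _ _ ⟨0, Or.inr (hz (a x)).symm⟩).symm
  have hrepb : ∀ x, rep (b x) = rep x := fun x => by
    refine (hrepeq _ _ ⟨-1, Or.inr ?_⟩).symm
    rw [← hkx, zpow_one]; exact (ha (b x)).symm
  refine ⟨c, fun x => ?_, fun x => hRne _ _ _ (hcR x), fun x => ?_, fun x => ?_⟩
  · refine hRu (rep x) (c x) _ _ ?_ (hRsymm _ _ _ (hcR x))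
    have := hcR (c x)
    rwa [hcrep] at this
  · refine hRu (rep x) (a x) _ _ ?_ (hRa _ _ _ (hcR x))
    have := hcR (a x)
    rwa [hrepa] at this
  · refine hRu (rep x) (b x) _ _ ?_ (hRb _ _ _ (hcR x))
    have := hcR (b x)
    rwa [hrepb] at this

lemma exists_equiv_fin (E : Type*) [Infinite E] (n : ℕ) (hn : 0 < n) :
    Nonempty (E ≃ E × Fin n) := by
  have : Cardinal.mk (E × Fin n) = Cardinal.mk E := by
    rw [Cardinal.mk_prod, Cardinal.mk_fin, Cardinal.lift_natCast, Cardinal.lift_uzero]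
    refine Cardinal.mul_eq_left (Cardinal.aleph0_le_mk E) ?_ (by exact_mod_cast hn.ne')
    exact (Cardinal.natCast_le_aleph0).trans (Cardinal.aleph0_le_mk E)
  obtain ⟨e⟩ := Cardinal.eq.1 this
  exact ⟨e.symm⟩

lemma exists_nrel (E : Type*) [Infinite E] (n : ℕ) (hn : 0 < n) : ∃ θ : Setoid E, IsNRel n θ := by
  obtain ⟨g⟩ := exists_equiv_fin E n hn
  refine ⟨Setoid.ker fun x => (g x).1, fun x => ?_⟩
  have e : {y // (Setoid.ker fun x => (g x).1) x y} ≃ Fin n :=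
    { toFun := fun y => (g y.1).2
      invFun := fun i => ⟨g.symm ((g x).1, i), by simp [Setoid.ker_def]⟩
      left_inv := by
        rintro ⟨y, hy⟩
        rw [Setoid.ker_def] at hy
        apply Subtype.ext
        apply g.injective
        ext <;> simp [hy]
      right_inv := fun i => by simp }
  rw [Nat.card_congr e, Nat.card_fin]

/-- Quotient by a setoid with finite classes is infinite. -/
lemma quot_infinite [Infinite Y] (o : Setoid Y) (h : ∀ x, {y | o x y}.Finite) :
    Infinite (Quotient o) := by
  rw [← not_finite_iff_infinite]
  intro hf
  have : (⋃ q : Quotient o, {y | o q.out y}).Finite := Set.finite_iUnion fun q => h _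
  obtain ⟨z, hz⟩ := this.exists_notMem
  simp only [Set.mem_iUnion, not_exists] at hz
  exact hz (Quotient.mk o z) (Quotient.exact (s := o) (Quotient.out_eq _))

/-- Every 2-relation on an infinite set lies below a 4-relation. -/
lemma exists_above [Infinite Y] {π : Setoid Y} (h : IsNRel 2 π) : ∃ θ, IsNRel 4 θ ∧ π ≤ θ := by
  have hq : Infinite (Quotient π) := quot_infinite π fun x =>
    Set.finite_of_ncard_ne_zero (by rw [(nrel_iff 2 π).1 h x]; omega)
  obtain ⟨ν, hν⟩ := exists_nrel (Quotient π) 2 (by omega)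
  obtain ⟨p, hpf, hpp, hp⟩ := two_fun h
  obtain ⟨n, hnf, hnn, hn⟩ := two_fun hν
  refine ⟨ν.comap (Quotient.mk π), four_of fun x => ?_, fun {x y} hxy => ?_⟩
  · set y := (n (Quotient.mk π x)).out with hy
    have hyn : Quotient.mk π y = n (Quotient.mk π x) := Quotient.out_eq _
    have hmk : ∀ u v, Quotient.mk π u = Quotient.mk π v ↔ v = u ∨ v = p u := fun u v => by
      rw [← hp]; exact ⟨fun h => Quotient.exact h, fun h => Quotient.sound h⟩
    have hne : ∀ u, (u = x ∨ u = p x) → u ≠ y ∧ u ≠ p y := by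
      intro u hu
      have h1 : Quotient.mk π x = Quotient.mk π u := (hmk _ _).2 hu
      constructor
      · intro h
        exact hnf (Quotient.mk π x) (by rw [← hyn, ← h, h1])
      · intro h
        have h2 : Quotient.mk π y = Quotient.mk π u := (hmk _ _).2 (Or.inr h)
        exact hnf (Quotient.mk π x) (by rw [← hyn, h1, h2])
    refine ⟨p x, y, p y, (hpf x).symm, (hne x (Or.inl rfl)).1, (hne x (Or.inl rfl)).2,
      (hne _ (Or.inr rfl)).1, (hne _ (Or.inr rfl)).2, (hpf y).symm, fun z => ?_⟩
    rw [Setoid.comap_rel, hn, ← hyn, eq_comm, hmk, eq_comm (a := Quotient.mk π z), hmk]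
    tauto
  · rw [Setoid.comap_rel, show Quotient.mk π x = Quotient.mk π y from Quotient.sound hxy]

/-- Two 2-relations with a common 4-relation above. -/
def Adj (a b : Setoid Y) : Prop := ∃ θ, IsNRel 4 θ ∧ a ≤ θ ∧ b ≤ θ

lemma adj_of_commute {a d : Y → Y} (ha : ∀ x, a (a x) = x) (hd : ∀ x, d (d x) = x)
    (haf : ∀ x, a x ≠ x) (hdf : ∀ x, d x ≠ x) (hc : ∀ x, d (a x) = a (d x))
    (hinf : {x | a x = d x}.Infinite) : Adj (inv a ha) (inv d hd) := by
  -- `Z` is the set where `a` and `d` differ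
  set Z : Set Y := {x | a x ≠ d x} with hZ
  have hcomp : Zᶜ = {x | a x = d x} := by ext x; simp [hZ]
  have hZa : ∀ x, a x ∈ Z ↔ x ∈ Z := fun x => by
    simp only [hZ, Set.mem_setOf_eq, hc, ne_eq]
    refine not_congr ⟨fun h => ?_, fun h => by rw [h]⟩
    have := congrArg a h; rwa [ha, ha] at this
  have hZd : ∀ x, d x ∈ Z ↔ x ∈ Z := fun x => by
    simp only [hZ, Set.mem_setOf_eq, ← hc, ne_eq]
    refine not_congr ⟨fun h => ?_, fun h => by rw [h]⟩
    have := congrArg d h; rwa [hd, hd] at this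
  have hsa : Sat (inv a ha) Z := by
    rintro x y (rfl | rfl)
    · exact Iff.rfl
    · exact (hZa x).symm
  have hsd : Sat (inv d hd) Z := by
    rintro x y (rfl | rfl)
    · exact Iff.rfl
    · exact (hZd x).symm
  have : Infinite ↥(Zᶜ) := by rw [hcomp]; exact hinf.to_subtype
  obtain ⟨s, hs4, hs⟩ := exists_above (res_nrel hsa (inv_nrel a ha haf))
  let r : Setoid Y :=
    { r := fun x y => y = x ∨ y = a x ∨ y = d x ∨ y = a (d x)
      iseqv := by
        refine ⟨fun x => Or.inl rfl, ?_, ?_⟩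
        · rintro x y (rfl | rfl | rfl | rfl) <;> simp [ha, hd, hc]
        · rintro x y z (rfl | rfl | rfl | rfl) (rfl | rfl | rfl | rfl) <;> simp [ha, hd, hc] }
  refine ⟨glue Z r s, glue_nrel ?_ hs4, le_glue hsa ?_ ?_, le_glue hsd ?_ ?_⟩
  · intro x hx
    have hx' : a x ≠ d x := hx
    have : {y | y ∈ Z ∧ r x y} = {x, a x, d x, a (d x)} := by
      ext y
      constructor
      · exact fun h => h.2
      · intro h
        refine ⟨?_, h⟩
        rcases h with rfl | rfl | rfl | rfl
        · exact hx
        · exact (hZa _).2 hx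
        · exact (hZd _).2 hx
        · exact (hZa _).2 ((hZd _).2 hx)
    rw [this]
    refine ncard_four (haf x).symm (hdf x).symm ?_ hx' ?_ (haf _).symm
    · intro h; exact hx' (by rw [h, ha, ← h])
    · intro h; exact hdf x (by rw [← ha (d x), ← h, ha])
  · rintro x _ y _ (rfl | rfl)
    · exact Or.inl rfl
    · exact Or.inr (Or.inl rfl)
  · intro x y h; exact hs h
  · rintro x _ y _ (rfl | rfl)
    · exact Or.inl rfl
    · exact Or.inr (Or.inr (Or.inl rfl))
  · intro x y h
    apply hs
    have hx' : a x.1 = d x.1 := not_not.1 x.2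
    rcases h with h | h
    · exact Or.inl h
    · exact Or.inr (by rw [h, hx'])

lemma chain_of_commute [Infinite Y] {a c : Y → Y} (ha : ∀ x, a (a x) = x) (hc : ∀ x, c (c x) = x)
    (haf : ∀ x, a x ≠ x) (hcf : ∀ x, c x ≠ x) (hac : ∀ x, c (a x) = a (c x)) :
    ∃ d : Setoid Y, IsNRel 2 d ∧ Adj (inv a ha) d ∧ Adj d (inv c hc) := by
  classical
  let o : Setoid Y :=
    { r := fun x y => y = x ∨ y = a x ∨ y = c x ∨ y = a (c x)
      iseqv := by
        refine ⟨fun x => Or.inl rfl, ?_, ?_⟩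
        · rintro x y (rfl | rfl | rfl | rfl) <;> simp [ha, hc, hac]
        · rintro x y z (rfl | rfl | rfl | rfl) (rfl | rfl | rfl | rfl) <;> simp [ha, hc, hac] }
  have : Infinite (Quotient o) := quot_infinite o fun x => by
    have : {y | o x y} = {x, a x, c x, a (c x)} := rfl
    rw [this]; exact Set.toFinite _
  obtain ⟨g⟩ := exists_equiv_fin (Quotient o) 2 (by omega)
  set col : Y → Fin 2 := fun x => (g (Quotient.mk o x)).2 with hcol
  have hcinf : ∀ i, {x | col x = i}.Infinite := by
    intro i
    have hinj : Function.Injective fun q : Quotient o => (g.symm (q, i)).out := by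
      intro q q' h
      have := Quotient.out_injective h
      simpa using this
    refine (Set.infinite_range_of_injective hinj).mono ?_
    rintro _ ⟨q, rfl⟩
    show (g (Quotient.mk o _)).2 = i
    rw [Quotient.out_eq]; simp
  have hcola : ∀ x, col (a x) = col x := fun x => by
    have : Quotient.mk o x = Quotient.mk o (a x) := Quotient.sound (s := o) (Or.inr (Or.inl rfl))
    simp only [hcol, this]
  have hcolc : ∀ x, col (c x) = col x := fun x => by
    have : Quotient.mk o x = Quotient.mk o (c x) :=
      Quotient.sound (s := o) (Or.inr (Or.inr (Or.inl rfl)))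
    simp only [hcol, this]
  let d : Y → Y := fun x => if col x = 0 then a x else c x
  have hd0 : ∀ x, col x = 0 → d x = a x := fun x h => if_pos h
  have hd1 : ∀ x, col x ≠ 0 → d x = c x := fun x h => if_neg h
  have hdd : ∀ x, d (d x) = x := fun x => by
    by_cases h : col x = 0
    · rw [hd0 x h, hd0 _ (by rw [hcola, h]), ha]
    · rw [hd1 x h, hd1 _ (by rw [hcolc]; exact h), hc]
  have hdf : ∀ x, d x ≠ x := fun x => by
    by_cases h : col x = 0
    · rw [hd0 x h]; exact haf x
    · rw [hd1 x h]; exact hcf x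
  refine ⟨inv d hdd, inv_nrel d hdd hdf, adj_of_commute ha hdd haf hdf ?_ ?_,
    adj_of_commute hdd hc hdf hcf ?_ ?_⟩
  · intro x
    by_cases h : col x = 0
    · rw [hd0 x h, hd0 _ (by rw [hcola, h])]
    · rw [hd1 x h, hd1 _ (by rw [hcola]; exact h), hac]
  · exact (hcinf 0).mono fun x hx => (hd0 x hx).symm
  · intro x
    by_cases h : col x = 0
    · rw [hd0 x h, hd0 _ (by rw [hcolc, h]), hac]
    · rw [hd1 x h, hd1 _ (by rw [hcolc]; exact h)]
  · refine (hcinf 1).mono fun x hx => hd1 x ?_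
    rw [show col x = 1 from hx]; decide

lemma Adj.symm {a b : Setoid Y} (h : Adj a b) : Adj b a := by
  obtain ⟨θ, h1, h2, h3⟩ := h
  exact ⟨θ, h1, h3, h2⟩

lemma connected [Infinite Y] (p : Setoid Y → Prop)
    (hp : ∀ a b, IsNRel 2 a → IsNRel 2 b → Adj a b → p a → p b) {a b : Setoid Y}
    (ha : IsNRel 2 a) (hb : IsNRel 2 b) (hpa : p a) : p b := by
  obtain ⟨f, hff, hf2, hf⟩ := two_fun ha
  obtain ⟨g, hgf, hg2, hg⟩ := two_fun hb
  have hae : a = inv f hf2 := Setoid.ext hf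
  have hbe : b = inv g hg2 := Setoid.ext hg
  obtain ⟨c, hc2, hcf, hca, hcb⟩ := reflection (Function.Involutive.toPerm f hf2)
    (Function.Involutive.toPerm g hg2) hf2 hg2 hff hgf
  have hcn := inv_nrel c hc2 hcf
  obtain ⟨d, hd, h1, h2⟩ := chain_of_commute hf2 hc2 hff hcf hca
  obtain ⟨d', hd', h3, h4⟩ := chain_of_commute hg2 hc2 hgf hcf hcb
  rw [← hae] at h1
  rw [← hbe] at h3
  exact hp _ _ hd' hb h3.symm (hp _ _ hcn hd' h4.symm (hp _ _ hd hcn h2 (hp _ _ ha hd h1 hpa)))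

/-- Every 4-relation lies above a 2-relation. -/
lemma exists_below {θ : Setoid Y} (h : IsNRel 4 θ) : ∃ π, IsNRel 2 π ∧ π ≤ θ := by
  have key : ∀ x : Y, Nonempty ({y // θ x y} ≃ Fin 4) := fun x => by
    have h1 := h x
    have : Finite {y // θ x y} := Nat.finite_of_card_ne_zero (by omega)
    exact ⟨(Finite.equivFin _).trans (finCongr h1)⟩
  let e : ∀ q : Quotient θ, {y // θ q.out y} ≃ Fin 4 := fun q => Classical.choice (key q.out)
  have hout : ∀ x, θ (Quotient.mk θ x).out x := fun x =>
    Quotient.exact (s := θ) (Quotient.out_eq _)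
  let k : Y → Fin 4 := fun x => e (Quotient.mk θ x) ⟨x, hout x⟩
  have hkinj : ∀ x y, θ x y → k x = k y → x = y := by
    intro x y hxy hk
    have hq : Quotient.mk θ x = Quotient.mk θ y := Quotient.sound hxy
    have : ∀ (q q' : Quotient θ) (hx : θ q.out x) (hy : θ q'.out y), q = q' →
        e q ⟨x, hx⟩ = e q' ⟨y, hy⟩ → x = y := by
      rintro q _ hx hy rfl h
      exact congrArg Subtype.val ((e q).injective h)
    exact this _ _ _ _ hq hk
  have hksurj : ∀ x i, ∃ y, θ x y ∧ k y = i := by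
    intro x i
    set y := (e (Quotient.mk θ x)).symm i with hy
    have hxy : θ x y.1 := θ.trans' (θ.symm' (hout x)) y.2
    refine ⟨y.1, hxy, ?_⟩
    have hq : Quotient.mk θ y.1 = Quotient.mk θ x := Quotient.sound (θ.symm' hxy)
    have : ∀ (q q' : Quotient θ) (hx : θ q.out y.1) (hy : θ q'.out y.1), q = q' →
        e q ⟨y.1, hx⟩ = e q' ⟨y.1, hy⟩ := by
      rintro q _ hx hy rfl; rfl
    refine (this _ _ (hout _) y.2 hq).trans ?_
    simp [hy]
  -- flip the last bit
  let fl : Fin 4 → Fin 4 := ![1, 0, 3, 2]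
  have hfl : ∀ i, fl (fl i) = i := by decide
  have hflne : ∀ i, fl i ≠ i := by decide
  choose p hp1 hp2 using fun x => hksurj x (fl (k x))
  have hpp : ∀ x, p (p x) = x := fun x => by
    refine (hkinj x (p (p x)) (θ.trans' (hp1 x) (hp1 _)) ?_).symm
    rw [hp2, hp2, hfl]
  have hpf : ∀ x, p x ≠ x := fun x hx => hflne (k x) (by rw [← hp2, hx])
  refine ⟨inv p hpp, inv_nrel p hpp hpf, ?_⟩
  rintro x y (rfl | rfl)
  · exact θ.refl' _
  · exact hp1 x

end conn
end EqS
namespace EqS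

section final
variable {X : Type*}

lemma fin_of_four {Q : Set X} (h : Q.ncard = 4) : Q.Finite :=
  Set.finite_of_ncard_ne_zero (by omega)

lemma glue_top [Infinite X] {Q : Set X} (hQ : Q.ncard = 4) {s : Setoid ↥(Qᶜ)} (hs : IsNRel 4 s) :
    IsNRel 4 (glue Q ⊤ s) ∧ Blk (glue Q ⊤ s) Q := by
  have htop : ∀ x y : X, (⊤ : Setoid X) x y := fun x y => trivial
  refine ⟨glue_nrel (fun x hx => ?_) hs, ?_⟩
  · rw [← hQ]; congr 1; ext y; exact ⟨fun h => h.1, fun h => ⟨h, htop _ _⟩⟩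
  · obtain ⟨x, hx⟩ := Set.nonempty_of_ncard_ne_zero (s := Q) (by omega)
    exact blk_of (x := x) fun y => by
      rw [glue_in hx]; exact ⟨fun h => ⟨h, htop _ _⟩, fun h => h.1⟩

variable {e2 : NR 2 X ≃ NR 2 X} {e4 : NR 4 X ≃ NR 4 X}

lemma rel_unique [Infinite X] (hc : Compat e2 e4) {π ρ : NR 2 X} {Q P P' : Set X}
    (h : Rel e4 π Q P) (h' : Rel e4 ρ Q P') : P = P' := by
  obtain ⟨θ, hle, hb, -⟩ := h.1
  obtain ⟨θ', hle', hb', -⟩ := h'.1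
  have hQ4 := hb.ncard θ.2
  have hsat := hb.sat.mono hle
  have hsat' := hb'.sat.mono hle'
  have : Infinite ↥(Qᶜ) := (fin_of_four hQ4).infinite_compl.to_subtype
  have hG : ∀ s : Setoid ↥(Qᶜ), IsNRel 2 s → IsNRel 2 (glue Q π.1 s) := fun s hs =>
    glue_nrel (sat_ncard hsat π.2) hs
  have key := connected (fun s : Setoid ↥(Qᶜ) => ∀ hs : IsNRel 2 s,
      Rel e4 ⟨glue Q π.1 s, hG s hs⟩ Q P) (by
    rintro a b ha hb ⟨φ, hφ, hle1, hle2⟩ hpa hb'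
    obtain ⟨h4, hblk⟩ := glue_top hQ4 hφ
    have l1 : glue Q π.1 a ≤ glue Q ⊤ φ := by
      rintro x y (⟨h1, h2, h3⟩ | ⟨h1, h2, h3⟩)
      · exact Or.inl ⟨h1, h2, trivial⟩
      · exact Or.inr ⟨h1, h2, hle1 h3⟩
    have l2 : glue Q π.1 b ≤ glue Q ⊤ φ := by
      rintro x y (⟨h1, h2, h3⟩ | ⟨h1, h2, h3⟩)
      · exact Or.inl ⟨h1, h2, trivial⟩
      · exact Or.inr ⟨h1, h2, hle2 h3⟩
    obtain ⟨P2, hP2⟩ := rel_exists hc (π := ⟨glue Q π.1 b, hG b hb'⟩) (θ := ⟨_, h4⟩) l2 hblk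
    have := rel_indep hc (π := ⟨glue Q π.1 a, hG a ha⟩) (ρ := ⟨glue Q π.1 b, hG b hb'⟩)
      (θ := ⟨_, h4⟩) l1 l2 hblk (hpa ha) hP2
    rw [this]; exact hP2)
    (res_nrel hsat π.2) (res_nrel hsat' ρ.2) (by
      intro hs
      have : (⟨glue Q π.1 (res Q π.1), hG _ hs⟩ : NR 2 X) = π := by
        apply Subtype.ext
        apply Setoid.ext
        intro x y
        by_cases hx : x ∈ Q
        · exact glue_sat_in hsat hx y
        · exact glue_res_out hsat hx y
      rw [this]; exact h) (res_nrel hsat' ρ.2)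
  refine rel_indep hc (θ := θ') ?_ hle' hb' key h'
  exact glue_le (fun x hx y hy _ => (hb'.mem hx y).1 hy) (fun x y hxy => hle' hxy)

/-- The correspondence on 4-sets. -/
def Fr (e4 : NR 4 X ≃ NR 4 X) (Q P : Set X) : Prop := ∃ π : NR 2 X, Rel e4 π Q P

lemma Fr.symm (hc : Compat e2 e4) {Q P : Set X} (h : Fr e4 Q P) : Fr e4.symm P Q := by
  obtain ⟨π, h⟩ := h
  exact ⟨e2 π, h.symm hc⟩

lemma Fr.card {Q P : Set X} (h : Fr e4 Q P) : Q.ncard = 4 ∧ P.ncard = 4 := by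
  obtain ⟨π, ⟨θ, -, h1, h2⟩, -⟩ := h
  exact ⟨h1.ncard θ.2, h2.ncard (e4 θ).2⟩

lemma Fr.uniq [Infinite X] (hc : Compat e2 e4) {Q P P' : Set X} (h : Fr e4 Q P)
    (h' : Fr e4 Q P') : P = P' := by
  obtain ⟨π, h⟩ := h
  obtain ⟨π', h'⟩ := h'
  exact rel_unique hc h h'

lemma fr_exists [Infinite X] (hc : Compat e2 e4) {Q : Set X} (hQ : Q.ncard = 4) :
    ∃ P, Fr e4 Q P := by
  have : Infinite ↥(Qᶜ) := (fin_of_four hQ).infinite_compl.to_subtype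
  obtain ⟨s, hs⟩ := exists_nrel ↥(Qᶜ) 4 (by omega)
  obtain ⟨h4, hb⟩ := glue_top hQ hs
  obtain ⟨π, h2, hle⟩ := exists_below h4
  obtain ⟨P, hP⟩ := rel_exists hc (π := ⟨π, h2⟩) (θ := ⟨_, h4⟩) hle hb
  exact ⟨P, _, hP⟩

lemma fr_disj [Infinite X] (hc : Compat e2 e4) {Q R P S : Set X} (h : Fr e4 Q P) (h' : Fr e4 R S)
    (hd : Disjoint Q R) : Disjoint P S := by
  have hQ := h.card.1
  have hR := h'.card.1
  have hd' := Set.disjoint_left.1 hd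
  have : Infinite ↥((Q ∪ R)ᶜ) :=
    ((fin_of_four hQ).union (fin_of_four hR)).infinite_compl.to_subtype
  obtain ⟨s, hs⟩ := exists_nrel ↥((Q ∪ R)ᶜ) 4 (by omega)
  have h4 : IsNRel 4 (glue (Q ∪ R) (spl Q) s) := by
    refine glue_nrel (spl_ncard ?_ ?_) hs
    · rw [← hQ]; congr 1; ext x; simp only [Set.mem_inter_iff, Set.mem_union]; tauto
    · rw [← hR]; congr 1; ext x; simp only [Set.mem_sdiff, Set.mem_union]
      have := @hd' x
      tauto
  have bQ : Blk (glue (Q ∪ R) (spl Q) s) Q := by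
    obtain ⟨x, hx⟩ := Set.nonempty_of_ncard_ne_zero (s := Q) (by omega)
    refine blk_of (x := x) fun y => ?_
    rw [glue_in (show x ∈ Q ∪ R from Or.inl hx)]
    exact ⟨fun h => ⟨Or.inl h, iff_of_true hx h⟩, fun h => h.2.1 hx⟩
  have bR : Blk (glue (Q ∪ R) (spl Q) s) R := by
    obtain ⟨x, hx⟩ := Set.nonempty_of_ncard_ne_zero (s := R) (by omega)
    have hxQ : x ∉ Q := fun h => hd' h hx
    refine blk_of (x := x) fun y => ?_
    rw [glue_in (show x ∈ Q ∪ R from Or.inr hx)]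
    refine ⟨fun h => ⟨Or.inr h, iff_of_false hxQ fun h' => hd' h' h⟩, fun h => ?_⟩
    rcases h.1 with h' | h'
    · exact absurd (h.2.2 h') hxQ
    · exact h'
  obtain ⟨π, h2, hle⟩ := exists_below h4
  obtain ⟨P', hP'⟩ := rel_exists hc (π := ⟨π, h2⟩) (θ := ⟨_, h4⟩) hle bQ
  obtain ⟨S', hS'⟩ := rel_exists hc (π := ⟨π, h2⟩) (θ := ⟨_, h4⟩) hle bR
  obtain rfl : P = P' := h.uniq hc ⟨_, hP'⟩
  obtain rfl : S = S' := h'.uniq hc ⟨_, hS'⟩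
  have b1 := hP'.blk (θ := ⟨_, h4⟩) hle bQ
  have b2 := hS'.blk (θ := ⟨_, h4⟩) hle bR
  rw [Set.disjoint_left]
  intro z hz hz'
  obtain rfl := b1.eq_of_mem b2 hz hz'
  have hQR : R = Q := hP'.inj hS'
  obtain ⟨x, hx⟩ := bQ.nonempty
  exact hd' hx (hQR ▸ hx)

lemma four_set [Infinite X] (x : X) {B : Set X} (hB : B.Finite) (hx : x ∉ B) :
    ∃ W : Set X, W.ncard = 4 ∧ x ∈ W ∧ Disjoint W B := by
  obtain ⟨t, hts, htf, htc⟩ := (hB.insert x).infinite_compl.exists_subset_ncard_eq 3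
  refine ⟨insert x t, ?_, Set.mem_insert _ _, ?_⟩
  · rw [Set.ncard_insert_of_notMem (fun h => hts h (Set.mem_insert _ _)) htf, htc]
  · rw [Set.disjoint_left]
    rintro y (rfl | hy) hyB
    · exact hx hyB
    · exact hts hy (Set.mem_insert_of_mem _ hyB)

lemma fr_cover [Infinite X] (hc : Compat e2 e4) {T U S T' U' S' : Set X} (hT : Fr e4 T T')
    (hU : Fr e4 U U') (hS : Fr e4 S S') (h : T ⊆ U ∪ S) : T' ⊆ U' ∪ S' := by
  intro t ht
  by_contra hcon
  obtain ⟨W', hW4, htW, hWd⟩ := four_set t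
    ((fin_of_four hU.card.2).union (fin_of_four hS.card.2)) hcon
  obtain ⟨W, hW⟩ := fr_exists hc.symm hW4
  rw [Set.disjoint_union_right] at hWd
  have d1 := fr_disj hc.symm hW (hU.symm hc) hWd.1
  have d2 := fr_disj hc.symm hW (hS.symm hc) hWd.2
  have d3 : Disjoint W T := (Set.disjoint_union_right.2 ⟨d1, d2⟩).mono_right h
  have hW' : Fr e4 W W' := by
    have := hW.symm hc.symm
    simpa using this
  exact Set.disjoint_left.1 (fr_disj hc hW' hT d3) htW ht

lemma fr_point [Infinite X] (hc : Compat e2 e4) (x : X) :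
    ∃ y, ∀ S P, Fr e4 S P → x ∈ S → y ∈ P := by
  obtain ⟨T, hT4, hxT, -⟩ := four_set x Set.finite_empty (Set.notMem_empty x)
  obtain ⟨z, hz⟩ := (fin_of_four hT4).exists_notMem
  set U := insert z (T \ {x}) with hU
  have hU4 : U.ncard = 4 := by
    rw [hU, Set.ncard_insert_of_notMem (fun h => hz h.1) ((fin_of_four hT4).sdiff),
      Set.ncard_sdiff_singleton_of_mem hxT, hT4]
  have hxU : x ∉ U := by
    rintro (h | h)
    · exact hz (h ▸ hxT)
    · exact h.2 rfl
  obtain ⟨T', hT'⟩ := fr_exists hc hT4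
  obtain ⟨U', hU'⟩ := fr_exists hc hU4
  have : ∃ y ∈ T', y ∉ U' := by
    by_contra hcon
    push Not at hcon
    have heq : T' = U' := Set.eq_of_subset_of_ncard_le hcon
      (by rw [hT'.card.2, hU'.card.2]) (fin_of_four hU'.card.2)
    subst heq
    have := (hT'.symm hc).uniq hc.symm (hU'.symm hc)
    exact hxU (this ▸ hxT)
  obtain ⟨y, hyT, hyU⟩ := this
  refine ⟨y, fun S P hSP hxS => ?_⟩
  have hcov : T ⊆ U ∪ S := by
    intro t ht
    by_cases h : t = x
    · exact Or.inr (h ▸ hxS)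
    · exact Or.inl (Or.inr ⟨ht, h⟩)
  exact (fr_cover hc hT' hU' hSP hcov hyT).resolve_left hyU

lemma fr_perm [Infinite X] (hc : Compat e2 e4) :
    ∃ σ : Equiv.Perm X, ∀ S P, Fr e4 S P → ∀ x, x ∈ S ↔ σ x ∈ P := by
  choose s hs using fr_point hc
  choose r hr using fr_point hc.symm
  have h1 : ∀ x, r (s x) = x := by
    intro x
    by_contra hne
    obtain ⟨W, hW, hxW, hd⟩ := four_set x (Set.finite_singleton (r (s x))) (fun h => hne h.symm)
    obtain ⟨P, hP⟩ := fr_exists hc hW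
    exact Set.disjoint_left.1 hd (hr _ _ _ (hP.symm hc) (hs _ _ _ hP hxW)) rfl
  have h2 : ∀ x, s (r x) = x := by
    intro x
    by_contra hne
    obtain ⟨W, hW, hxW, hd⟩ := four_set x (Set.finite_singleton (s (r x))) (fun h => hne h.symm)
    obtain ⟨P, hP⟩ := fr_exists hc.symm hW
    have hP' : Fr e4 P W := by
      have := hP.symm hc.symm
      simpa using this
    exact Set.disjoint_left.1 hd (hs _ _ _ hP' (hr _ _ _ hP hxW)) rfl
  refine ⟨⟨s, r, h1, h2⟩, fun S P h x => ⟨hs x S P h, fun hx => ?_⟩⟩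
  have := hr _ _ _ (h.symm hc) hx
  have h3 : r (s x) ∈ S := this
  rwa [h1] at h3

lemma main [Infinite X] (hc : Compat e2 e4) :
    ∃ σ : Equiv.Perm X, ∀ π : NR 2 X, (e2 π).1 = permSetoid σ π.1 := by
  obtain ⟨σ, hσ⟩ := fr_perm hc
  refine ⟨σ, fun π => ?_⟩
  obtain ⟨p, hpf, hpp, hp⟩ := two_fun π.2
  have key : ∀ x w, (e2 π).1 (σ x) (σ w) → π.1 x w := by
    intro x w hxw
    have step : ∀ (θ : NR 4 X) (Q : Set X), π.1 ≤ θ.1 → Blk θ.1 Q → x ∈ Q → w ∈ Q := by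
      intro θ Q hle hQ hx
      obtain ⟨P, hP⟩ := rel_exists hc hle hQ
      have hb := hP.blk hle hQ
      rw [hσ Q P ⟨π, hP⟩] at hx ⊢
      exact ((hb.sat.mono ((hc _ _).1 hle)) _ _ hxw).1 hx
    obtain ⟨θ, h4, hle⟩ := exists_above π.2
    have hQ : Blk θ {z | θ x z} := ⟨x, rfl⟩
    have hxQ : x ∈ {z | θ x z} := θ.refl' x
    obtain ⟨R, hR, hRd⟩ := exists_blk_not ⟨θ, h4⟩ {z | θ x z} (Blk.finite (θ := ⟨θ, h4⟩) hQ)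
    obtain ⟨θ2, h42, hle2, -, hn, -⟩ := regroup π.2 π.2 h4 hle hle hQ hR
      (hR.ne_of_disj hRd subset_rfl).symm (fun _ _ _ => Iff.rfl) (fun _ _ _ => Iff.rfl)
    have w1 := step ⟨θ, h4⟩ _ hle hQ hxQ
    have w2 := step ⟨θ2, h42⟩ {z | θ2 x z} hle2 ⟨x, rfl⟩ (θ2.refl' x)
    obtain ⟨y, hyx, hyp, hz⟩ := blk_shape π.2 h4 hle hQ hxQ hpf hpp hp
    rw [hp]
    by_contra hw
    have hw' : w = y ∨ w = p y := by
      have := (hz w).1 w1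
      tauto
    have hpy : ∀ u, θ2 u (p u) := fun u => hle2 ((hp _ _).2 (Or.inr rfl))
    have hy2 : θ2 x y := by
      rcases hw' with rfl | rfl
      · exact w2
      · exact θ2.trans' w2 (θ2.symm' (hpy y))
    apply hn
    refine blk_of (x := x) fun z => ?_
    rw [hz]
    refine (four_cls h42 (hpf x).symm hyx.symm ?_ hyp.symm ?_ (hpf y).symm (hpy x) hy2
      (θ2.trans' hy2 (hpy y)) z).symm
    · intro h; exact hyp (by rw [h, hpp])
    · intro h; exact hyx (by rw [← hpp y, ← h, hpp])
  obtain ⟨q, hqf, hqq, hq⟩ := two_fun (e2 π).2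
  apply Setoid.ext
  intro u v
  have hfwd : ∀ u v, (e2 π).1 u v → π.1 (σ.symm u) (σ.symm v) := fun u v h =>
    key _ _ (by simpa using h)
  refine ⟨hfwd u v, fun h => ?_⟩
  have h' : π.1 (σ.symm u) (σ.symm v) := h
  have hqu := hfwd u (q u) ((hq _ _).2 (Or.inr rfl))
  rw [hp] at h' hqu
  rw [hq]
  rcases h' with h' | h'
  · exact Or.inl (σ.symm.injective h')
  · right
    rcases hqu with h3 | h3
    · exact absurd (σ.symm.injective h3) (hqf u)
    · exact σ.symm.injective (h'.trans h3.symm)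

end final
end EqS

/-- Let `X` be infinite and `β` an order automorphism of `Eq*(X)` that sends
`n`-relations to `n`-relations. Then there is a permutation `σ` of `X` with
`β(π) = σ(π)` for every `2`-relation `π`. -/
theorem eqStar_automorphism_from_permutation (X : Type*) [Infinite X]
    (β : EqStar X → EqStar X) (hbij : Function.Bijective β)
    (hord : ∀ θ φ : EqStar X, θ.1 ≤ φ.1 ↔ (β θ).1 ≤ (β φ).1)
    (hsize : ∀ n : ℕ, 0 < n → ∀ θ : EqStar X, IsNRel n θ.1 ↔ IsNRel n (β θ).1) :
    ∃ σ : Equiv.Perm X, ∀ θ : EqStar X, IsNRel 2 θ.1 →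
      (β θ).1 = permSetoid σ θ.1 := by
  have mk : ∀ n : ℕ, 0 < n → ∃ e : EqS.NR n X ≃ EqS.NR n X, ∀ (θ : EqS.NR n X) (h : _),
      (e θ).1 = (β ⟨θ.1, h⟩).1 := by
    intro n hn
    let f : EqS.NR n X → EqS.NR n X := fun θ =>
      ⟨(β ⟨θ.1, n, hn, θ.2⟩).1, (hsize n hn ⟨θ.1, n, hn, θ.2⟩).1 θ.2⟩
    have hf : Function.Bijective f := by
      constructor
      · intro a b hab
        have h0 : (f a).1 = (f b).1 := by rw [hab]
        have h1 : β ⟨a.1, n, hn, a.2⟩ = β ⟨b.1, n, hn, b.2⟩ :=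
          Subtype.ext h0
        have h2 := hbij.1 h1
        have h3 : a.1 = b.1 := Subtype.mk.inj h2
        exact Subtype.ext h3
      · intro b
        obtain ⟨a, ha⟩ := hbij.2 ⟨b.1, n, hn, b.2⟩
        refine ⟨⟨a.1, (hsize n hn a).2 (by rw [ha]; exact b.2)⟩, Subtype.ext ?_⟩
        have h0 : (β a).1 = b.1 := by rw [ha]
        exact h0
    exact ⟨Equiv.ofBijective f hf, fun θ h => rfl⟩
  obtain ⟨e2, h2⟩ := mk 2 (by omega)
  obtain ⟨e4, h4⟩ := mk 4 (by omega)
  have hc : EqS.Compat e2 e4 := by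
    intro π θ
    rw [h2 π ⟨2, by omega, π.2⟩, h4 θ ⟨4, by omega, θ.2⟩]
    exact hord ⟨π.1, 2, by omega, π.2⟩ ⟨θ.1, 4, by omega, θ.2⟩
  obtain ⟨σ, hσ⟩ := EqS.main hc
  refine ⟨σ, fun θ hθ => ?_⟩
  rw [← hσ ⟨θ.1, hθ⟩]
  exact (h2 ⟨θ.1, hθ⟩ θ.2).symm
end
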